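/- Let f be a probability density on (0,∞) and define r(α) := ∫₀^∞ exp(−α·b(t) − α²·t/2)·f(t) dt for α > 0. Assume: (a) r is completely monotone on (0,∞); (b) whenever z : (0,∞) → ℝ is Lebesgue integrable and ∫₀^∞ exp(−α·b(t) − α²·t/2)·z(t) dt = 0 for every α > 0, then z = 0 almost everywhere. Then there exists a Borel probability measure q on [0,∞) such that ∫_{[0,∞)} e^{−αx} dq(x) = r(α) for every α > 0 and ∫_{[0,∞)} K(t,x) dq(x) = f(t) for almost every t > 0. -/

import Mathlib

open MeasureTheory Real Set

/-- A function `r` is completely monotone on `(0,∞)` if it is infinitely differentiable there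
and `(−1)^n r^{(n)}(α) ≥ 0` for every `n ≥ 0` and every `α > 0`. -/
def CompletelyMonotoneOn (r : ℝ → ℝ) : Prop :=
  ContDiffOn ℝ ((⊤ : ℕ∞) : WithTop ℕ∞) r (Ioi 0) ∧
    ∀ n : ℕ, ∀ α ∈ Ioi (0 : ℝ), 0 ≤ (-1 : ℝ) ^ n * iteratedDerivWithin n r (Ioi 0) α

open Filter Topology ProbabilityTheory
open scoped ENNReal NNReal

section CompletelyMonotone

open scoped Nat

/-- The Taylor sum with moving centre `t` telescopes under differentiation. -/
lemma hasDerivAt_taylor_sum {d : ℕ → ℝ → ℝ}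
    (hd : ∀ n, ∀ u > 0, HasDerivAt (d n) (-d (n + 1) u) u) (x : ℝ) (n : ℕ) {t : ℝ} (ht : 0 < t) :
    HasDerivAt (fun t => ∑ k ∈ Finset.range (n + 1), d k t * (t - x) ^ k / k !)
      (-(d (n + 1) t * (t - x) ^ n / n !)) t := by
  induction n with
  | zero => simpa using hd 0 t ht
  | succ n ih =>
    simp_rw [Finset.sum_range_succ _ (n + 1)]
    have h1 : HasDerivAt (fun t : ℝ => (t - x) ^ (n + 1)) (((n + 1 : ℕ) : ℝ) * (t - x) ^ n) t := by
      simpa using ((hasDerivAt_id t).sub_const x).fun_pow (n + 1)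
    have h2 := ih.add (((hd (n + 1) t ht).mul h1).div_const ((n + 1)! : ℝ))
    refine h2.congr_deriv ?_
    rw [Nat.factorial_succ]
    have : (n ! : ℝ) ≠ 0 := by positivity
    have : ((n : ℝ) + 1) ≠ 0 := by positivity
    push_cast
    field_simp
    ring

/-- Cauchy's form of the remainder for a function expanded to the left of its centre. -/
lemma exists_taylor_remainder {d : ℕ → ℝ → ℝ}
    (hd : ∀ n, ∀ u > 0, HasDerivAt (d n) (-d (n + 1) u) u) {x A : ℝ} (hx : 0 < x) (hxA : x < A)
    (n : ℕ) :
    ∃ c ∈ Ioo x A, d 0 x - ∑ k ∈ Finset.range (n + 1), d k A * (A - x) ^ k / k ! =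
      d (n + 1) c * (c - x) ^ n / n ! * (A - x) := by
  obtain ⟨c, hc, h⟩ := exists_hasDerivAt_eq_slope
    (fun t => ∑ k ∈ Finset.range (n + 1), d k t * (t - x) ^ k / k !)
    (fun t => -(d (n + 1) t * (t - x) ^ n / n !)) hxA
    (fun t ht => (hasDerivAt_taylor_sum hd x n (hx.trans_le ht.1)).continuousAt.continuousWithinAt)
    (fun t ht => hasDerivAt_taylor_sum hd x n (hx.trans ht.1))
  refine ⟨c, hc, ?_⟩
  have h0 : ∑ k ∈ Finset.range (n + 1), d k x * (x - x) ^ k / k ! = d 0 x := by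
    rw [Finset.sum_range_succ']
    simp
  rw [h0, eq_div_iff (by linarith)] at h
  linarith

/-- A completely monotone function on `(0,∞)` is the sum of its Taylor series at `A`
on the whole of `(0,A)`. -/
lemma hasSum_taylor_of_completelyMonotone {d : ℕ → ℝ → ℝ}
    (hd : ∀ n, ∀ u > 0, HasDerivAt (d n) (-d (n + 1) u) u) (h0 : ∀ n, ∀ u > 0, 0 ≤ d n u)
    {x A : ℝ} (hx : 0 < x) (hxA : x ≤ A) :
    HasSum (fun k => d k A * (A - x) ^ k / k !) (d 0 x) := by
  rcases hxA.eq_or_lt with rfl | hxA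
  · simpa using hasSum_single (f := fun k => d k x * (x - x) ^ k / k !) 0
      (fun k hk => by simp [hk])
  have hA : 0 < A := hx.trans hxA
  rw [hasSum_iff_tendsto_nat_of_nonneg
    (fun k => div_nonneg (mul_nonneg (h0 k A hA) (pow_nonneg (by linarith) _)) (by positivity)),
    ← tendsto_add_atTop_iff_nat 1, ← tendsto_sub_nhds_zero_iff]
  set y := x / 2 with hy
  have hy0 : 0 < y := by positivity
  have hyx : y < x := by linarith
  set q := (A - x) / (A - y) with hq
  have hq0 : 0 ≤ q := div_nonneg (by linarith) (by linarith)
  have hq1 : q < 1 := by rw [hq, div_lt_one (by linarith)]; linarith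
  have hlim : Tendsto (fun n : ℕ => d 0 y * ((A - x) / (x - y)) * (((n : ℝ) + 1) * q ^ n))
      atTop (𝓝 0) := by
    have h1 := tendsto_self_mul_const_pow_of_lt_one hq0 hq1
    have h2 := tendsto_pow_atTop_nhds_zero_of_lt_one hq0 hq1
    have h3 := (h1.add h2).const_mul (d 0 y * ((A - x) / (x - y)))
    simpa [add_mul] using h3
  rw [tendsto_zero_iff_norm_tendsto_zero]
  refine squeeze_zero (fun n => norm_nonneg _) (fun n => ?_) hlim
  obtain ⟨c, hc, hR⟩ := exists_taylor_remainder hd hx hxA n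
  have hc0 : 0 < c := hx.trans hc.1
  rw [norm_sub_rev, hR]
  have hyc : y < c := hyx.trans hc.1
  obtain ⟨c', hc', hR'⟩ := exists_taylor_remainder hd hy0 hyc (n + 1)
  have hle : d (n + 1) c * (c - y) ^ (n + 1) / (n + 1)! ≤ d 0 y := by
    have hr : 0 ≤ d (n + 1 + 1) c' * (c' - y) ^ (n + 1) / (n + 1)! * (c - y) := by
      have := h0 (n + 1 + 1) c' (hy0.trans hc'.1)
      have h1 : 0 ≤ c' - y := by linarith [hc'.1]
      have h2 : 0 ≤ c - y := by linarith
      positivity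
    rw [← hR', Finset.sum_range_succ] at hr
    have hs : 0 ≤ ∑ k ∈ Finset.range (n + 1), d k c * (c - y) ^ k / k ! :=
      Finset.sum_nonneg fun k _ =>
        div_nonneg (mul_nonneg (h0 k c hc0) (pow_nonneg (by linarith) _)) (by positivity)
    linarith
  have hcx : 0 ≤ c - x := by linarith [hc.1]
  have hcy : 0 < c - y := by linarith
  have hxy : 0 < x - y := by linarith
  have hAx : 0 < A - x := by linarith
  have hdc := h0 (n + 1) c hc0
  rw [Real.norm_of_nonneg (by positivity)]
  have hratio : (c - x) / (c - y) ≤ q := by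
    rw [hq, div_le_div_iff₀ hcy (by linarith)]
    nlinarith [hc.2]
  have hD : 0 ≤ d 0 y := h0 0 y hy0
  have hfac : ((n + 1)! : ℝ) = (n + 1) * n ! := by
    rw [Nat.factorial_succ]; push_cast; ring
  calc d (n + 1) c * (c - x) ^ n / n ! * (A - x)
      = (d (n + 1) c * (c - y) ^ (n + 1) / (n + 1)!) * ((A - x) / (c - y)) *
          ((n + 1) * ((c - x) / (c - y)) ^ n) := by
        rw [hfac]
        have : (n ! : ℝ) ≠ 0 := by positivity
        have : ((n : ℝ) + 1) ≠ 0 := by positivity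
        rw [div_pow]
        field_simp
        ring
    _ ≤ d 0 y * ((A - x) / (x - y)) * (((n : ℝ) + 1) * q ^ n) := by
        have h4 : x - y ≤ c - y := by linarith [hc.1]
        gcongr

lemma tendsto_mul_one_sub_exp_neg_div (α : ℝ) :
    Tendsto (fun N : ℕ => (N : ℝ) * (1 - exp (-(α / N)))) atTop (𝓝 α) := by
  have h : HasDerivAt (fun u : ℝ => 1 - exp (-(α * u))) α 0 := by
    have h1 : HasDerivAt (fun u : ℝ => -(α * u)) (-α) 0 := by
      simpa using ((hasDerivAt_id (0 : ℝ)).const_mul α).fun_neg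
    simpa using h1.exp.const_sub 1
  have h2 := h.tendsto_slope_zero_right
  have h3 : Tendsto (fun N : ℕ => ((N : ℝ))⁻¹) atTop (𝓝[>] 0) :=
    tendsto_inv_atTop_nhdsGT_zero.comp tendsto_natCast_atTop_atTop
  refine (h2.comp h3).congr fun N => ?_
  simp [div_eq_mul_inv]

/-- A completely monotone function is, after normalisation at `1`, a moment function
of a probability measure on `[0,1]`. -/
lemma exists_probabilityMeasure_lintegral_rpow {d : ℕ → ℝ → ℝ}
    (hd : ∀ n, ∀ u > 0, HasDerivAt (d n) (-d (n + 1) u) u) (h0 : ∀ n, ∀ u > 0, 0 ≤ d n u)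
    (h1 : 0 < d 0 1) :
    ∃ ν : ProbabilityMeasure unitInterval, ∀ α > 0,
      ∫⁻ y, ENNReal.ofReal ((y : ℝ) ^ α) ∂(ν : Measure unitInterval) =
        ENNReal.ofReal (d 0 (1 + α) / d 0 1) := by
  set c : ℕ → ℕ → ℝ := fun N k => d k (1 + N) * (N : ℝ) ^ k / k ! with hc
  have hc0 : ∀ N k, 0 ≤ c N k := fun N k =>
    div_nonneg (mul_nonneg (h0 k _ (by positivity)) (by positivity)) (by positivity)
  have hsum : ∀ N : ℕ, ∀ s : ℝ, 0 ≤ s → s ≤ 1 →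
      HasSum (fun k => c N k * s ^ k) (d 0 (1 + N * (1 - s))) := by
    intro N s hs0 hs1
    have hN : (0 : ℝ) ≤ N := N.cast_nonneg
    have := hasSum_taylor_of_completelyMonotone hd h0 (x := 1 + N * (1 - s)) (A := 1 + N)
      (by nlinarith) (by nlinarith)
    convert this using 2 with k
    rw [hc]
    simp only
    ring
  let p : ℕ → ℕ → unitInterval := fun N k => ⟨exp (-(k / N)), by
    constructor
    · positivity
    · rw [exp_le_one_iff]; simp only [neg_nonpos]; positivity⟩
  let μ : ℕ → Measure unitInterval := fun N =>
    Measure.sum fun k => ENNReal.ofReal (c N k / d 0 1) • Measure.dirac (p N k)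
  have hμ : ∀ N : ℕ, ∀ α : ℝ, 0 ≤ α → ∫⁻ y, ENNReal.ofReal ((y : ℝ) ^ α) ∂(μ N) =
      ENNReal.ofReal (d 0 (1 + N * (1 - exp (-(α / N)))) / d 0 1) := by
    intro N α hα
    have hs := (hsum N (exp (-(α / N))) (by positivity)
      (by rw [exp_le_one_iff]; simp only [neg_nonpos]; positivity)).div_const (d 0 1)
    rw [lintegral_sum_measure, ← hs.tsum_eq, ENNReal.ofReal_tsum_of_nonneg _ hs.summable]
    · refine tsum_congr fun k => ?_
      have hm : Measurable fun y : unitInterval => ENNReal.ofReal ((y : ℝ) ^ α) := by fun_prop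
      rw [lintegral_smul_measure, lintegral_dirac' _ hm, smul_eq_mul,
        ← ENNReal.ofReal_mul (div_nonneg (hc0 N k) h1.le), mul_div_right_comm]
      congr 2
      change exp (-(k / N)) ^ α = _
      rw [← exp_mul, ← exp_nat_mul]
      congr 1
      ring
    · intro k
      have := hc0 N k
      positivity
  have hprob : ∀ N, IsProbabilityMeasure (μ N) := fun N => ⟨by
    have := hμ N 0 le_rfl
    simpa [h1.ne'] using this⟩
  let P : ℕ → ProbabilityMeasure unitInterval := fun N => ⟨μ N, hprob N⟩
  obtain ⟨ν, -, hν⟩ := isCompact_univ.ultrafilter_le_nhds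
    ((hyperfilter ℕ).map P) (by simp)
  refine ⟨ν, fun α hα => ?_⟩
  have hcont : Continuous fun y : unitInterval => (y : ℝ) ^ α :=
    continuous_subtype_val.rpow_const fun _ => Or.inr hα.le
  let g : BoundedContinuousFunction unitInterval ℝ≥0 :=
    BoundedContinuousFunction.mkOfCompact ⟨fun y => Real.toNNReal ((y : ℝ) ^ α),
      continuous_real_toNNReal.comp hcont⟩
  have hP : Tendsto P (hyperfilter ℕ) (𝓝 ν) := hν
  have hlim := ProbabilityMeasure.tendsto_iff_forall_lintegral_tendsto.1 hP g
  refine tendsto_nhds_unique hlim ?_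
  change Tendsto (fun N => ∫⁻ y, ENNReal.ofReal ((y : ℝ) ^ α) ∂(μ N)) _ _
  simp_rw [fun N => hμ N α hα.le]
  refine (ENNReal.tendsto_ofReal (Tendsto.div_const ?_ _)).mono_left
    (Nat.hyperfilter_le_atTop)
  exact (hd 0 (1 + α) (by positivity)).continuousAt.tendsto.comp
    ((tendsto_mul_one_sub_exp_neg_div α).const_add 1)

/-- Bernstein's theorem, in the form of a representation on `(1,∞)`. -/
lemma exists_measure_lintegral_exp_of_completelyMonotone {d : ℕ → ℝ → ℝ}
    (hd : ∀ n, ∀ u > 0, HasDerivAt (d n) (-d (n + 1) u) u) (h0 : ∀ n, ∀ u > 0, 0 ≤ d n u)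
    (h1 : 0 < d 0 1) :
    ∃ q : Measure ℝ, SFinite q ∧ q (Iio 0) = 0 ∧ ∀ α > 1,
      ∫⁻ x, ENNReal.ofReal (exp (-α * x)) ∂q = ENNReal.ofReal (d 0 α) := by
  obtain ⟨ν, hν⟩ := exists_probabilityMeasure_lintegral_rpow hd h0 h1
  set ν' : Measure unitInterval := (ν : Measure unitInterval).restrict {0}ᶜ
  have hlog : Measurable fun y : unitInterval => -log (y : ℝ) := by fun_prop
  set q₀ : Measure ℝ := ν'.map fun y : unitInterval => -log (y : ℝ)
  refine ⟨ENNReal.ofReal (d 0 1) • q₀.withDensity fun x => ENNReal.ofReal (exp x),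
    ?_, ?_, fun α hα => ?_⟩
  · have : SFinite (q₀.withDensity fun x => ENNReal.ofReal (exp x)) := inferInstance
    infer_instance
  · have : q₀ (Iio 0) = 0 := by
      rw [Measure.map_apply hlog measurableSet_Iio]
      convert measure_empty (μ := ν')
      ext y
      simpa using log_nonpos y.2.1 y.2.2
    rw [Measure.smul_apply, withDensity_absolutelyContinuous _ _ this, smul_zero]
  · rw [lintegral_smul_measure, lintegral_withDensity_eq_lintegral_mul _ (by fun_prop)
      (by fun_prop), lintegral_map ((by fun_prop : Measurable _).mul (by fun_prop)) hlog]
    have h2 : ∀ y : unitInterval, y ∈ ({0}ᶜ : Set unitInterval) →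
        ((fun x => ENNReal.ofReal (exp x)) * fun x => ENNReal.ofReal (exp (-α * x)))
          (-log (y : ℝ)) = ENNReal.ofReal ((y : ℝ) ^ (α - 1)) := by
      intro y hy
      have hy' : 0 < (y : ℝ) := unitInterval.pos_iff_ne_zero.2 hy
      rw [Pi.mul_apply, ← ENNReal.ofReal_mul (exp_pos _).le, ← exp_add, rpow_def_of_pos hy']
      congr 2
      ring
    rw [setLIntegral_congr_fun (measurableSet_singleton _).compl h2]
    have h3 : ∫⁻ y in ({0}ᶜ : Set unitInterval), ENNReal.ofReal ((y : ℝ) ^ (α - 1)) ∂ν =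
        ∫⁻ y, ENNReal.ofReal ((y : ℝ) ^ (α - 1)) ∂(ν : Measure unitInterval) := by
      rw [← lintegral_indicator (measurableSet_singleton _).compl]
      refine lintegral_congr fun y => ?_
      by_cases hy : y = 0
      · simp [hy, zero_rpow (sub_ne_zero.2 hα.ne')]
      · simp [hy]
    rw [h3, hν _ (by linarith), smul_eq_mul, ← ENNReal.ofReal_mul h1.le]
    congr 1
    rw [mul_div_cancel₀ _ h1.ne']
    congr 1
    ring

end CompletelyMonotone

/-- An integral of entire functions dominated on an open set is holomorphic there. -/
lemma differentiableOn_integral_of_dominated {X : Type*} [MeasurableSpace X] {μ : Measure X}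
    {U : Set ℂ} (hU : IsOpen U) {F : ℂ → X → ℂ} (hmeas : ∀ z, AEStronglyMeasurable (F z) μ)
    (hdiff : ∀ t, Differentiable ℂ fun z => F z t) {g : X → ℝ} (hg : Integrable g μ)
    (hbound : ∀ᵐ t ∂μ, ∀ z ∈ U, ‖F z t‖ ≤ g t) :
    DifferentiableOn ℂ (fun z => ∫ t, F z t ∂μ) U := by
  intro z₀ hz₀
  obtain ⟨R, hR, hRU⟩ := Metric.isOpen_iff.1 hU z₀ hz₀
  have hcl : ∀ w ∈ Metric.ball z₀ (R / 2), Metric.closedBall w (R / 4) ⊆ U := by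
    intro w hw x hx
    refine hRU ?_
    rw [Metric.mem_ball] at hw ⊢
    rw [Metric.mem_closedBall] at hx
    linarith [dist_triangle x w z₀]
  refine (hasDerivAt_integral_of_dominated_loc_of_deriv_le (F := F)
    (F' := fun z t => deriv (fun z => F z t) z) (bound := fun t => g t / (R / 4))
    (Metric.ball_mem_nhds z₀ (half_pos hR)) (Eventually.of_forall hmeas) ?_ ?_ ?_
    (hg.div_const _) ?_).2.differentiableAt.differentiableWithinAt
  · exact hg.mono' (hmeas z₀) (hbound.mono fun t ht => ht z₀ hz₀)
  · have hlim : Tendsto (fun n : ℕ => ((1 / ((n : ℝ) + 1) : ℝ) : ℂ)) atTop (𝓝[≠] 0) := by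
      rw [tendsto_nhdsWithin_iff]
      constructor
      · rw [← Complex.ofReal_zero]
        exact (Complex.continuous_ofReal.tendsto 0).comp tendsto_one_div_add_atTop_nhds_zero_nat
      · refine Eventually.of_forall fun n => ?_
        simp only [mem_compl_iff, mem_singleton_iff, Complex.ofReal_eq_zero]
        positivity
    refine aestronglyMeasurable_of_tendsto_ae atTop
      (f := fun (n : ℕ) t => ((1 / ((n : ℝ) + 1) : ℝ) : ℂ)⁻¹ •
        (F (z₀ + ((1 / ((n : ℝ) + 1) : ℝ) : ℂ)) t - F z₀ t))
      (fun n => ((hmeas _).fun_sub (hmeas _)).fun_const_smul _) (Eventually.of_forall fun t => ?_)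
    exact ((hdiff t z₀).hasDerivAt.tendsto_slope_zero).comp hlim
  · refine hbound.mono fun t ht w hw => ?_
    exact Complex.norm_deriv_le_of_forall_mem_sphere_norm_le (by positivity)
      (hdiff t).diffContOnCl fun z hz => ht z (hcl w hw (Metric.sphere_subset_closedBall hz))
  · exact Eventually.of_forall fun t z _ => (hdiff t z).hasDerivAt

/-- The exponential kernel of the boundary transform at a complex parameter. -/
noncomputable def boundaryKernel (b : ℝ → ℝ) (α : ℂ) (t : ℝ) : ℂ :=
  Complex.exp (-α * b t - α ^ 2 * t / 2)

lemma boundaryKernel_ofReal (b : ℝ → ℝ) (α t : ℝ) :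
    boundaryKernel b α t = (exp (-α * b t - α ^ 2 * t / 2) : ℝ) := by
  simp [boundaryKernel]

lemma differentiable_boundaryKernel (b : ℝ → ℝ) (t : ℝ) :
    Differentiable ℂ fun α => boundaryKernel b α t := by
  unfold boundaryKernel
  fun_prop

lemma continuous_boundaryKernel {b : ℝ → ℝ} (hb : Continuous b) (α : ℂ) :
    Continuous (boundaryKernel b α) := by
  unfold boundaryKernel
  fun_prop

lemma norm_boundaryKernel (b : ℝ → ℝ) (β : ℝ) (w : ℂ) (t : ℝ) :
    ‖boundaryKernel b (β + w) t‖ = exp (-β * b t - β ^ 2 * t / 2) *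
      exp (-w.re * (b t + β * t) - (w.re ^ 2 - w.im ^ 2) * t / 2) := by
  rw [boundaryKernel, Complex.norm_exp, ← exp_add]
  congr 1
  simp [pow_two]
  ring

lemma norm_boundaryKernel_le {b : ℝ → ℝ} {β m : ℝ} {w : ℂ} {t : ℝ} (ht : 0 ≤ t)
    (hm : m ≤ b t + β * t) (hw : |w.im| ≤ w.re) :
    ‖boundaryKernel b (β + w) t‖ ≤ exp (-β * b t - β ^ 2 * t / 2) * exp (-m * w.re) := by
  rw [norm_boundaryKernel]
  gcongr
  have h1 : w.im ^ 2 ≤ w.re ^ 2 := sq_le_sq' (by linarith [neg_abs_le w.im])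
    (by linarith [le_abs_self w.im])
  have h2 : 0 ≤ w.re := (abs_nonneg _).trans hw
  nlinarith [mul_nonneg (sub_nonneg.2 h1) ht, mul_le_mul_of_nonneg_left hm h2]

/-- The boundary transform extends holomorphically to a sector. -/
lemma differentiableOn_integral_boundaryKernel {b : ℝ → ℝ} (hb : Continuous b) {ρ : Measure ℝ}
    (hρ : ρ (Iic 0) = 0) {β m : ℝ} (hm : ∀ t ≥ 0, m ≤ b t + β * t)
    (hint : Integrable (fun t => exp (-β * b t - β ^ 2 * t / 2)) ρ) :
    DifferentiableOn ℂ (fun w => ∫ t, boundaryKernel b (β + w) t ∂ρ)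
      {w : ℂ | |w.im| < w.re} := by
  have hpos : ∀ᵐ t ∂ρ, 0 ≤ t := by
    have : ∀ᵐ t ∂ρ, t ∉ Iic (0 : ℝ) := measure_eq_zero_iff_ae_notMem.1 hρ
    filter_upwards [this] with t ht
    exact (not_le.1 ht).le
  intro w hw
  have hU : IsOpen {z : ℂ | |z.im| < z.re ∧ z.re < w.re + 1} :=
    (isOpen_lt Complex.continuous_im.abs Complex.continuous_re).inter
      (isOpen_lt Complex.continuous_re continuous_const)
  refine ((differentiableOn_integral_of_dominated (F := fun w t => boundaryKernel b (β + w) t)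
    hU (fun z => (continuous_boundaryKernel hb _).aestronglyMeasurable)
    (fun t => (differentiable_boundaryKernel b t).comp (differentiable_id.const_add _))
    (hint.mul_const (exp (|m| * (w.re + 1)))) ?_).differentiableAt
    (hU.mem_nhds ⟨hw, by simp⟩)).differentiableWithinAt
  filter_upwards [hpos] with t ht z hz
  refine (norm_boundaryKernel_le ht (hm t ht) hz.1.le).trans ?_
  refine mul_le_mul_of_nonneg_left (exp_le_exp.2 ?_) (exp_pos _).le
  have h0 : 0 ≤ z.re := (abs_nonneg _).trans hz.1.le
  calc -m * z.re ≤ |m| * z.re := by gcongr; exact neg_le_abs m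
    _ ≤ |m| * (w.re + 1) := by gcongr; exact hz.2.le

/-- Equality of boundary transforms far out on the real axis propagates to a sector. -/
lemma integral_boundaryKernel_eq_of_sector {b : ℝ → ℝ} (hb : Continuous b) {ρ₁ ρ₂ : Measure ℝ}
    (hρ₁ : ρ₁ (Iic 0) = 0) (hρ₂ : ρ₂ (Iic 0) = 0) {β m : ℝ} (hm : ∀ t ≥ 0, m ≤ b t + β * t)
    (hint₁ : Integrable (fun t => exp (-β * b t - β ^ 2 * t / 2)) ρ₁)
    (hint₂ : Integrable (fun t => exp (-β * b t - β ^ 2 * t / 2)) ρ₂) {A : ℝ}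
    (heq : ∀ α ≥ A, ∫ t, exp (-α * b t - α ^ 2 * t / 2) ∂ρ₁ =
      ∫ t, exp (-α * b t - α ^ 2 * t / 2) ∂ρ₂) {w : ℂ} (hw : |w.im| < w.re) :
    ∫ t, boundaryKernel b (β + w) t ∂ρ₁ = ∫ t, boundaryKernel b (β + w) t ∂ρ₂ := by
  have hU : IsOpen {z : ℂ | |z.im| < z.re} :=
    isOpen_lt Complex.continuous_im.abs Complex.continuous_re
  have hconv : Convex ℝ {z : ℂ | |z.im| < z.re} := by
    intro x hx y hy s t hs ht hst
    simp only [mem_ofPred_eq] at hx hy ⊢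
    simp only [Complex.add_im, Complex.add_re, Complex.real_smul, Complex.mul_im, Complex.mul_re,
      Complex.ofReal_re, Complex.ofReal_im, zero_mul, sub_zero, add_zero]
    refine abs_lt.2 ?_
    rw [abs_lt] at hx hy
    rcases hs.eq_or_lt with rfl | hs
    · have : t = 1 := by linarith
      subst this
      constructor <;> linarith
    · constructor <;> nlinarith
  set x₀ : ℝ := max 1 (A - β + 1)
  have hx₀ : (x₀ : ℂ) ∈ {z : ℂ | |z.im| < z.re} := by
    simp only [mem_ofPred_eq, Complex.ofReal_im, Complex.ofReal_re, abs_zero]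
    exact lt_of_lt_of_le one_pos (le_max_left _ _)
  refine AnalyticOnNhd.eqOn_of_preconnected_of_frequently_eq
    ((differentiableOn_integral_boundaryKernel hb hρ₁ hm hint₁).analyticOnNhd hU)
    ((differentiableOn_integral_boundaryKernel hb hρ₂ hm hint₂).analyticOnNhd hU)
    hconv.isPreconnected hx₀ ?_ hw
  have hlim : Tendsto (fun u : ℝ => (u : ℂ)) (𝓝[>] x₀) (𝓝[≠] (x₀ : ℂ)) := by
    refine tendsto_nhdsWithin_iff.2
      ⟨(Complex.continuous_ofReal.tendsto x₀).mono_left inf_le_left, ?_⟩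
    filter_upwards [self_mem_nhdsWithin] with u hu
    simpa using (ne_of_gt hu)
  refine hlim.frequently (Eventually.frequently ?_)
  filter_upwards [self_mem_nhdsWithin] with u hu
  have hu' : A ≤ β + u := by
    have : A - β + 1 ≤ x₀ := le_max_right _ _
    have : x₀ < u := hu
    linarith
  have := heq _ hu'
  rw [← Complex.ofReal_add]
  simp_rw [boundaryKernel_ofReal, integral_complex_ofReal, this]

lemma integrable_exp_mul_const_sub {μ : Measure ℝ}
    (h : ∀ a : ℝ, Integrable (fun y => exp (a * y)) μ) (c a : ℝ) :
    Integrable (fun y => exp (a * (c - y))) μ := by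
  refine ((h (-a)).const_mul (exp (a * c))).congr (Eventually.of_forall fun y => ?_)
  simp only [← exp_add]
  congr 1
  ring

lemma differentiable_complexMGF_const_sub {μ : Measure ℝ}
    (h : ∀ a : ℝ, Integrable (fun y => exp (a * y)) μ) (c : ℝ) :
    Differentiable ℂ (complexMGF (fun y => c - y) μ) := by
  have hu : integrableExpSet (fun y => c - y) μ = univ :=
    eq_univ_of_forall fun a => integrable_exp_mul_const_sub h c a
  have := differentiableOn_complexMGF (X := fun y => c - y) (μ := μ)
  rw [hu] at this
  simpa [differentiableOn_univ] using this

lemma complexMGF_restrict_Iio_add_restrict_Ici {μ : Measure ℝ}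
    (h : ∀ a : ℝ, Integrable (fun y => exp (a * y)) μ) (c : ℝ) (z : ℂ) :
    complexMGF (fun y => c - y) (μ.restrict (Iio c)) z +
      complexMGF (fun y => c - y) (μ.restrict (Ici c)) z = complexMGF (fun y => c - y) μ z := by
  have hint : Integrable (fun y : ℝ => Complex.exp (z * (c - y : ℝ))) μ := by
    refine (integrable_exp_mul_const_sub h c z.re).mono' (by fun_prop)
      (Eventually.of_forall fun y => ?_)
    rw [Complex.norm_exp, Complex.mul_re, Complex.ofReal_re, Complex.ofReal_im, mul_zero, sub_zero]
  simpa [complexMGF] using integral_add_compl (s := Iio c) measurableSet_Iio hint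

/-- Two measures with exponential moments agree to the left of `c` as soon as their Laplace
transforms, recentred at `c`, are close enough to each other on a right half-plane. -/
lemma restrict_Iio_eq_of_norm_complexMGF_sub_le {μ₁ μ₂ : Measure ℝ} [IsFiniteMeasure μ₁]
    [IsFiniteMeasure μ₂] (h₁ : ∀ a : ℝ, Integrable (fun y => exp (a * y)) μ₁)
    (h₂ : ∀ a : ℝ, Integrable (fun y => exp (a * y)) μ₂) {c β B C : ℝ} (hβ : 0 ≤ β)
    (hgrow : ∀ w : ℂ, 0 ≤ w.re → ‖complexMGF (fun y => c - y) μ₁ (β + w) -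
      complexMGF (fun y => c - y) μ₂ (β + w)‖ ≤ C * exp (B * ‖w‖))
    (hreal : ∀ x : ℝ, 0 ≤ x → ‖complexMGF (fun y => c - y) μ₁ (β + x) -
      complexMGF (fun y => c - y) μ₂ (β + x)‖ ≤ C) :
    μ₁.restrict (Iio c) = μ₂.restrict (Iio c) := by
  have hr : ∀ {μ : Measure ℝ}, (∀ a : ℝ, Integrable (fun y => exp (a * y)) μ) → ∀ s : Set ℝ,
      ∀ a : ℝ, Integrable (fun y => exp (a * y)) (μ.restrict s) :=
    fun h s a => (h a).mono_measure Measure.restrict_le_self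
  have hL : ∀ {μ : Measure ℝ}, (∀ a : ℝ, Integrable (fun y => exp (a * y)) μ) → ∀ w : ℂ,
      w.re ≤ 0 → ‖complexMGF (fun y => c - y) (μ.restrict (Iio c)) (β + w)‖ ≤
        mgf (fun y => c - y) (μ.restrict (Iio c)) β := by
    intro μ h w hw
    refine norm_complexMGF_le_mgf.trans ?_
    refine integral_mono_ae (integrable_exp_mul_const_sub (hr h _) c _)
      (integrable_exp_mul_const_sub (hr h _) c _) ?_
    filter_upwards [ae_restrict_mem measurableSet_Iio] with y hy
    have hy' : y < c := hy
    refine exp_le_exp.2 (mul_le_mul_of_nonneg_right ?_ (by linarith))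
    simpa using hw
  have hR : ∀ {μ : Measure ℝ} [IsFiniteMeasure μ],
      (∀ a : ℝ, Integrable (fun y => exp (a * y)) μ) → ∀ w : ℂ,
      0 ≤ w.re → ‖complexMGF (fun y => c - y) (μ.restrict (Ici c)) (β + w)‖ ≤
        (μ.restrict (Ici c)).real univ := by
    intro μ _ h w hw
    refine norm_complexMGF_le_mgf.trans ?_
    rw [mgf, ← mul_one ((μ.restrict (Ici c)).real univ), ← smul_eq_mul, ← integral_const]
    refine integral_mono_ae (integrable_exp_mul_const_sub (hr h _) c _)
      (integrable_const _) ?_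
    filter_upwards [ae_restrict_mem measurableSet_Ici] with y hy
    have hy' : c ≤ y := hy
    refine exp_le_one_iff.2 (mul_nonpos_of_nonneg_of_nonpos ?_ (by linarith))
    simp only [Complex.add_re, Complex.ofReal_re]
    linarith
  set D : ℂ → ℂ := fun w => complexMGF (fun y => c - y) (μ₁.restrict (Iio c)) (β + w) -
    complexMGF (fun y => c - y) (μ₂.restrict (Iio c)) (β + w) with hD
  have hDdiff : Differentiable ℂ D :=
    ((differentiable_complexMGF_const_sub (hr h₁ _) c).comp (differentiable_id.const_add _)).sub
      ((differentiable_complexMGF_const_sub (hr h₂ _) c).comp (differentiable_id.const_add _))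
  set C₁ := mgf (fun y => c - y) (μ₁.restrict (Iio c)) β +
    mgf (fun y => c - y) (μ₂.restrict (Iio c)) β
  set C₂ := (μ₁.restrict (Ici c)).real univ + (μ₂.restrict (Ici c)).real univ
  have hC₂ : 0 ≤ C₂ := by positivity
  have hDleft : ∀ w : ℂ, w.re ≤ 0 → ‖D w‖ ≤ C₁ := fun w hw =>
    (norm_sub_le _ _).trans (add_le_add (hL h₁ w hw) (hL h₂ w hw))
  have hDright : ∀ w : ℂ, 0 ≤ w.re → ‖D w‖ ≤ ‖complexMGF (fun y => c - y) μ₁ (β + w) -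
      complexMGF (fun y => c - y) μ₂ (β + w)‖ + C₂ := by
    intro w hw
    have e : D w = (complexMGF (fun y => c - y) μ₁ (β + w) -
      complexMGF (fun y => c - y) μ₂ (β + w)) -
        (complexMGF (fun y => c - y) (μ₁.restrict (Ici c)) (β + w) -
          complexMGF (fun y => c - y) (μ₂.restrict (Ici c)) (β + w)) := by
      rw [← complexMGF_restrict_Iio_add_restrict_Ici h₁,
        ← complexMGF_restrict_Iio_add_restrict_Ici h₂]
      simp only [hD]
      ring
    rw [e]
    exact (norm_sub_le _ _).trans (add_le_add le_rfl
      ((norm_sub_le _ _).trans (add_le_add (hR h₁ w hw) (hR h₂ w hw))))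
  have hDhalf : ∀ w : ℂ, 0 ≤ w.re → ‖D w‖ ≤ C₁ := by
    intro w hw
    refine PhragmenLindelof.right_half_plane_of_bounded_on_real hDdiff.diffContOnCl
      ⟨1, one_lt_two, |B|, ?_⟩ ?_ (fun x => hDleft _ (by simp)) hw
    · refine Asymptotics.IsBigO.of_bound (|C| + C₂) ?_
      refine eventually_inf_principal.2 (Eventually.of_forall fun z hz => ?_)
      have hz' : 0 ≤ z.re := le_of_lt hz
      refine (hDright z hz').trans ?_
      rw [rpow_one, Real.norm_of_nonneg (exp_pos _).le, add_mul]
      refine add_le_add ((hgrow z hz').trans ?_) ?_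
      · refine mul_le_mul (le_abs_self C) (exp_le_exp.2 ?_) (exp_pos _).le (abs_nonneg _)
        exact mul_le_mul_of_nonneg_right (le_abs_self B) (norm_nonneg _)
      · exact le_mul_of_one_le_right hC₂ (one_le_exp (by positivity))
    · refine isBoundedUnder_of_eventually_le (a := C + C₂) ?_
      filter_upwards [eventually_ge_atTop 0] with x hx
      exact (hDright x (by simpa using hx)).trans (add_le_add (hreal x hx) le_rfl)
  have hconst : ∀ z w, D z = D w := by
    refine hDdiff.apply_eq_apply_of_bounded ?_
    refine (Metric.isBounded_closedBall (x := (0 : ℂ)) (r := C₁)).subset ?_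
    rintro _ ⟨w, rfl⟩
    rw [mem_closedBall_zero_iff]
    exact (le_total w.re 0).elim (hDleft w) (hDhalf w)
  have hlim : ∀ {μ : Measure ℝ}, (∀ a : ℝ, Integrable (fun y => exp (a * y)) μ) →
      Tendsto (fun n : ℕ => complexMGF (fun y => c - y) (μ.restrict (Iio c)) (β + (-(n : ℂ))))
        atTop (𝓝 0) := by
    intro μ h
    have := tendsto_integral_of_dominated_convergence
      (F := fun (n : ℕ) (y : ℝ) => Complex.exp ((β + (-(n : ℂ))) * (c - y : ℝ)))
      (f := fun _ => 0) (μ := μ.restrict (Iio c)) (fun y => exp (β * (c - y)))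
      (fun n => by fun_prop) (integrable_exp_mul_const_sub (hr h _) c _) ?_ ?_
    · simpa [complexMGF] using this
    · intro n
      filter_upwards [ae_restrict_mem measurableSet_Iio] with y hy
      have hy' : y < c := hy
      rw [Complex.norm_exp]
      refine exp_le_exp.2 ?_
      rw [Complex.re_mul_ofReal]
      refine mul_le_mul_of_nonneg_right ?_ (by linarith)
      simp
    · filter_upwards [ae_restrict_mem measurableSet_Iio] with y hy
      have hy' : 0 < c - y := sub_pos.2 hy
      rw [tendsto_zero_iff_norm_tendsto_zero]
      simp_rw [Complex.norm_exp, Complex.re_mul_ofReal]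
      refine tendsto_exp_atBot.comp (Tendsto.atBot_mul_const hy' ?_)
      simp only [Complex.add_re, Complex.ofReal_re, Complex.neg_re, Complex.natCast_re]
      exact tendsto_atBot_add_const_left _ _
        (tendsto_neg_atTop_atBot.comp tendsto_natCast_atTop_atTop)
  have hDzero : ∀ w, D w = 0 := by
    intro w
    have h0 : Tendsto (fun n : ℕ => D (-(n : ℂ))) atTop (𝓝 0) := by
      simpa [hD] using (hlim h₁).sub (hlim h₂)
    exact tendsto_nhds_unique (tendsto_const_nhds.congr fun n => hconst w _) h0
  refine Measure.ext_of_complexMGF_id_eq (funext fun z => ?_)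
  have hshift : ∀ μ : Measure ℝ, complexMGF id μ z =
      Complex.exp (z * c) * complexMGF (fun y => c - y) μ (β + (-z - β)) := by
    intro μ
    rw [complexMGF, complexMGF, ← integral_const_mul]
    refine integral_congr_ae (Eventually.of_forall fun y => ?_)
    simp only [← Complex.exp_add]
    congr 1
    push_cast
    simp only [id]
    ring
  rw [hshift, hshift, sub_eq_zero.1 (hDzero (-z - β))]

lemma measure_Ioc_lt_top_of_integrable {b : ℝ → ℝ} (hb : Continuous b) {ρ : Measure ℝ} {β : ℝ}
    (hint : Integrable (fun t => exp (-β * b t - β ^ 2 * t / 2)) ρ) (s : ℝ) :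
    ρ (Ioc 0 s) < ∞ := by
  have hcont : Continuous fun t => exp (-β * b t - β ^ 2 * t / 2) := by fun_prop
  obtain ⟨δ, hδ, hle⟩ := (isCompact_Icc (a := (0 : ℝ)) (b := s)).exists_forall_le'
    hcont.continuousOn (a := 0) fun t _ => exp_pos _
  refine lt_of_le_of_lt (measure_mono fun t ht => ?_) (hint.measure_norm_ge_lt_top hδ)
  change δ ≤ ‖_‖
  rw [Real.norm_of_nonneg (exp_pos _).le]
  exact hle t (Ioc_subset_Icc_self ht)

/-- The law at time `s` of Brownian motion started from the graph of `b`
at a time distributed according to `ρ` on `(0,s]`. -/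
noncomputable def heatPush (b : ℝ → ℝ) (ρ : Measure ℝ) (s : ℝ) : Measure ℝ :=
  ((ρ.restrict (Ioc 0 s)).prod (gaussianReal 0 1)).map fun p => b p.1 + √(s - p.1) * p.2

lemma lintegral_heatPush {b : ℝ → ℝ} (hb : Continuous b) (ρ : Measure ℝ) (s : ℝ)
    {φ : ℝ → ℝ≥0∞} (hφ : Measurable φ) :
    ∫⁻ y, φ y ∂(heatPush b ρ s) =
      ∫⁻ t in Ioc 0 s, ∫⁻ y, φ (b t + √(s - t) * y) ∂(gaussianReal 0 1) ∂ρ := by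
  rw [heatPush, lintegral_map hφ (by fun_prop), lintegral_prod _ (by fun_prop)]

lemma integrable_exp_mul_abs_gaussianReal (a : ℝ) :
    Integrable (fun y => exp (a * |y|)) (gaussianReal 0 1) :=
  integrable_exp_mul_abs (integrable_exp_mul_gaussianReal a) (integrable_exp_mul_gaussianReal (-a))

lemma integrable_exp_mul_heat {b : ℝ → ℝ} (hb : Continuous b) {ρ : Measure ℝ} {s : ℝ}
    (hρ : ρ (Ioc 0 s) < ∞) (a : ℝ) :
    Integrable (fun p : ℝ × ℝ => exp (a * (b p.1 + √(s - p.1) * p.2)))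
      ((ρ.restrict (Ioc 0 s)).prod (gaussianReal 0 1)) := by
  have : IsFiniteMeasure (ρ.restrict (Ioc 0 s)) := ⟨by simpa using hρ⟩
  obtain ⟨B, hB⟩ := (isCompact_Icc (a := (0 : ℝ)) (b := s)).exists_bound_of_continuousOn
    hb.continuousOn
  have hdom : Integrable (fun p : ℝ × ℝ => exp (|a| * B) * exp (|a| * √s * |p.2|))
      ((ρ.restrict (Ioc 0 s)).prod (gaussianReal 0 1)) :=
    ((integrable_exp_mul_abs_gaussianReal (|a| * √s)).comp_snd _).const_mul _
  refine hdom.mono' (by fun_prop) ?_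
  have hmem : ∀ᵐ p ∂((ρ.restrict (Ioc 0 s)).prod (gaussianReal 0 1)), p.1 ∈ Ioc 0 s :=
    Measure.quasiMeasurePreserving_fst.ae (ae_restrict_mem measurableSet_Ioc)
  filter_upwards [hmem] with p hp
  rw [Real.norm_of_nonneg (exp_pos _).le, ← exp_add]
  refine exp_le_exp.2 ((le_abs_self _).trans ?_)
  rw [abs_mul, mul_assoc, ← mul_add]
  refine mul_le_mul_of_nonneg_left ((abs_add_le _ _).trans ?_) (abs_nonneg a)
  refine add_le_add (hB _ (Ioc_subset_Icc_self hp)) ?_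
  rw [abs_mul, abs_of_nonneg (sqrt_nonneg _)]
  exact mul_le_mul_of_nonneg_right (sqrt_le_sqrt (by linarith [hp.1])) (abs_nonneg _)

lemma integrable_exp_mul_heatPush {b : ℝ → ℝ} (hb : Continuous b) {ρ : Measure ℝ} {s : ℝ}
    (hρ : ρ (Ioc 0 s) < ∞) (a : ℝ) : Integrable (fun y => exp (a * y)) (heatPush b ρ s) := by
  rw [heatPush, integrable_map_measure (by fun_prop) (by fun_prop)]
  exact integrable_exp_mul_heat hb hρ a

lemma isFiniteMeasure_heatPush {b : ℝ → ℝ} {ρ : Measure ℝ} {s : ℝ}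
    (hρ : ρ (Ioc 0 s) < ∞) : IsFiniteMeasure (heatPush b ρ s) := by
  have : IsFiniteMeasure (ρ.restrict (Ioc 0 s)) := ⟨by simpa using hρ⟩
  unfold heatPush
  infer_instance

lemma complexMGF_heatPush {b : ℝ → ℝ} (hb : Continuous b) {ρ : Measure ℝ} {s : ℝ}
    (hρ : ρ (Ioc 0 s) < ∞) (c : ℝ) (α : ℂ) :
    complexMGF (fun y => c - y) (heatPush b ρ s) α =
      ∫ t in Ioc 0 s, Complex.exp (α * c + α ^ 2 * s / 2) * boundaryKernel b α t ∂ρ := by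
  have : IsFiniteMeasure (ρ.restrict (Ioc 0 s)) := ⟨by simpa using hρ⟩
  rw [complexMGF, heatPush, integral_map (by fun_prop) (by fun_prop), integral_prod]
  · refine setIntegral_congr_fun measurableSet_Ioc fun t ht => ?_
    have hG := complexMGF_id_gaussianReal (μ := 0) (v := 1) (-α * (√(s - t) : ℝ))
    have hsq : ((√(s - t) : ℝ) : ℂ) ^ 2 = s - t := by
      rw [← Complex.ofReal_pow, sq_sqrt (by linarith [ht.2])]
      push_cast
      rfl
    rw [mul_pow, hsq, complexMGF] at hG
    have : ∀ y : ℝ, Complex.exp (α * ((c - (b t + √(s - t) * y) : ℝ) : ℂ)) =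
        Complex.exp (α * (c - b t)) * Complex.exp (-α * (√(s - t) : ℝ) * (id y : ℝ)) := by
      intro y
      rw [← Complex.exp_add]
      congr 1
      push_cast
      simp only [id]
      ring
    simp only [this]
    rw [integral_const_mul, hG, boundaryKernel, ← Complex.exp_add, ← Complex.exp_add]
    congr 1
    simp
    ring
  · refine (integrable_exp_mul_heat hb hρ (-α.re)).norm.const_mul (exp (α.re * c)) |>.mono'
      (by fun_prop) (Eventually.of_forall fun p => ?_)
    rw [Complex.norm_exp, Complex.re_mul_ofReal, Real.norm_of_nonneg (exp_pos _).le, ← exp_add]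
    refine le_of_eq ?_
    congr 1
    ring

lemma norm_exp_mul_boundaryKernel (b : ℝ → ℝ) (β c s t : ℝ) (w : ℂ) :
    ‖Complex.exp ((β + w) * c + (β + w) ^ 2 * s / 2) * boundaryKernel b (β + w) t‖ =
      exp (β * c + β ^ 2 * s / 2) * (exp (-β * b t - β ^ 2 * t / 2) *
        exp (-w.re * (b t + β * t - c - β * s) - (w.re ^ 2 - w.im ^ 2) * (t - s) / 2)) := by
  rw [norm_mul, norm_boundaryKernel, Complex.norm_exp, ← exp_add, ← exp_add, ← exp_add, ← exp_add]
  congr 1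
  simp [pow_two]
  ring

lemma integrable_boundaryKernel {b : ℝ → ℝ} (hb : Continuous b) {ρ : Measure ℝ}
    (hρ : ρ (Iic 0) = 0) {β m : ℝ} (hm : ∀ t ≥ 0, m ≤ b t + β * t)
    (hint : Integrable (fun t => exp (-β * b t - β ^ 2 * t / 2)) ρ) {w : ℂ} (hw : |w.im| ≤ w.re) :
    Integrable (boundaryKernel b (β + w)) ρ := by
  refine (hint.mul_const (exp (-m * w.re))).mono'
    (continuous_boundaryKernel hb _).aestronglyMeasurable ?_
  filter_upwards [measure_eq_zero_iff_ae_notMem.1 hρ] with t ht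
  have ht' : 0 ≤ t := (not_le.1 ht).le
  exact norm_boundaryKernel_le ht' (hm t ht') hw

lemma setIntegral_Ioc_add_Ioi {ρ : Measure ℝ} (hρ : ρ (Iic 0) = 0) {s : ℝ} (hs : 0 ≤ s)
    {F : ℝ → ℂ} (hF : Integrable F ρ) :
    ∫ t in Ioc 0 s, F t ∂ρ + ∫ t in Ioi s, F t ∂ρ = ∫ t, F t ∂ρ := by
  have h0 : ρ.restrict (Ioi 0) = ρ := by
    refine Measure.restrict_eq_self_of_ae_mem ?_
    filter_upwards [measure_eq_zero_iff_ae_notMem.1 hρ] with t ht using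
      not_le.1 (show ¬ t ≤ 0 from ht)
  rw [← setIntegral_union (Ioc_disjoint_Ioi le_rfl) measurableSet_Ioi hF.integrableOn
    hF.integrableOn, Ioc_union_Ioi_eq_Ioi hs, h0]

/-- A bound on the contribution of `(0,s]` outside the sector where the transforms agree. -/
lemma norm_complexMGF_heatPush_le {b : ℝ → ℝ} (hb : Continuous b) {ρ : Measure ℝ} {β s B : ℝ}
    (hβ : 0 ≤ β) (hρ : ρ (Ioc 0 s) < ∞) (c : ℝ) (hB : ∀ t ∈ Icc 0 s, ‖b t‖ ≤ B)
    {w : ℂ} (hw : 0 ≤ w.re) (hwim : w.re ≤ |w.im|) :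
    ‖complexMGF (fun y => c - y) (heatPush b ρ s) (β + w)‖ ≤
      exp (β * (|c| + B) + β ^ 2 * s / 2) * ρ.real (Ioc 0 s) *
        exp ((|c| + B + β * s) * ‖w‖) := by
  rw [complexMGF_heatPush hb hρ]
  have hsq : w.re ^ 2 ≤ w.im ^ 2 := by
    rw [← sq_abs w.im]
    exact pow_le_pow_left₀ hw hwim 2
  have hre : w.re ≤ ‖w‖ := (le_abs_self _).trans (Complex.abs_re_le_norm w)
  refine (norm_setIntegral_le_of_norm_le_const (C := exp (β * (|c| + B) + β ^ 2 * s / 2) *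
    exp ((|c| + B + β * s) * ‖w‖)) hρ fun t ht => ?_).trans_eq (by ring)
  rw [norm_exp_mul_boundaryKernel, ← exp_add, ← exp_add, ← exp_add]
  refine exp_le_exp.2 ?_
  have hbt : c - b t ≤ |c| + B := by
    have := hB t (Ioc_subset_Icc_self ht)
    rw [Real.norm_eq_abs] at this
    linarith [neg_abs_le (b t), le_abs_self c]
  have hcB : 0 ≤ |c| + B :=
    add_nonneg (abs_nonneg c) ((norm_nonneg _).trans (hB t (Ioc_subset_Icc_self ht)))
  have hst : 0 ≤ s - t := by linarith [ht.2]
  have hs0 : 0 ≤ s := by linarith [ht.1]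
  have e1 : β * c + β ^ 2 * s / 2 + (-β * b t - β ^ 2 * t / 2 +
      (-w.re * (b t + β * t - c - β * s) - (w.re ^ 2 - w.im ^ 2) * (t - s) / 2)) =
      β * (c - b t) + β ^ 2 * (s - t) / 2 + (w.re * (c - b t) + w.re * (β * (s - t)) -
        (w.im ^ 2 - w.re ^ 2) * (s - t) / 2) := by ring
  rw [e1]
  have i1 : β * (c - b t) ≤ β * (|c| + B) := mul_le_mul_of_nonneg_left hbt hβ
  have i2 : β ^ 2 * (s - t) ≤ β ^ 2 * s :=
    mul_le_mul_of_nonneg_left (by linarith [ht.1]) (sq_nonneg β)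
  have i3 : w.re * (c - b t) ≤ ‖w‖ * (|c| + B) :=
    (mul_le_mul_of_nonneg_left hbt hw).trans (mul_le_mul_of_nonneg_right hre hcB)
  have i4 : w.re * (β * (s - t)) ≤ ‖w‖ * (β * s) :=
    mul_le_mul hre (mul_le_mul_of_nonneg_left (by linarith [ht.1]) hβ) (by positivity)
      (norm_nonneg _)
  have i5 : 0 ≤ (w.im ^ 2 - w.re ^ 2) * (s - t) := mul_nonneg (by linarith) hst
  linarith

/-- The contribution of `(s,∞)` inside the sector. -/
lemma norm_setIntegral_Ioi_boundaryKernel_le {b : ℝ → ℝ} {ρ : Measure ℝ} {β s c L : ℝ} {w : ℂ}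
    (hint : Integrable (fun t => exp (-β * b t - β ^ 2 * t / 2)) ρ)
    (hL : ∀ t > s,
      exp (-w.re * (b t + β * t - c - β * s) - (w.re ^ 2 - w.im ^ 2) * (t - s) / 2) ≤ L) :
    ‖∫ t in Ioi s, Complex.exp ((β + w) * c + (β + w) ^ 2 * s / 2) *
      boundaryKernel b (β + w) t ∂ρ‖ ≤
      exp (β * c + β ^ 2 * s / 2) * (∫ t, exp (-β * b t - β ^ 2 * t / 2) ∂ρ) * L := by
  have h1 : ‖∫ t in Ioi s, Complex.exp ((β + w) * c + (β + w) ^ 2 * s / 2) *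
      boundaryKernel b (β + w) t ∂ρ‖ ≤
      ∫ t in Ioi s, exp (β * c + β ^ 2 * s / 2) * (exp (-β * b t - β ^ 2 * t / 2) * L) ∂ρ := by
    refine norm_integral_le_of_norm_le ((hint.integrableOn.mul_const L).const_mul _) ?_
    filter_upwards [ae_restrict_mem measurableSet_Ioi] with t ht
    rw [norm_exp_mul_boundaryKernel]
    have := hL t ht
    gcongr
  refine h1.trans ?_
  rw [integral_const_mul, integral_mul_const, ← mul_assoc]
  have hL0 : 0 ≤ L := (exp_pos _).le.trans (hL (s + 1) (by simp))
  refine mul_le_mul_of_nonneg_right (mul_le_mul_of_nonneg_left ?_ (exp_pos _).le) hL0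
  exact setIntegral_le_integral hint (Eventually.of_forall fun t => (exp_pos _).le)

lemma norm_complexMGF_heatPush_sub_le {b : ℝ → ℝ} (hb : Continuous b) {ρ₁ ρ₂ : Measure ℝ}
    (hρ₁ : ρ₁ (Iic 0) = 0) (hρ₂ : ρ₂ (Iic 0) = 0) {β m : ℝ} (hm : ∀ t ≥ 0, m ≤ b t + β * t)
    (hint₁ : Integrable (fun t => exp (-β * b t - β ^ 2 * t / 2)) ρ₁)
    (hint₂ : Integrable (fun t => exp (-β * b t - β ^ 2 * t / 2)) ρ₂) {A : ℝ}
    (heq : ∀ α ≥ A, ∫ t, exp (-α * b t - α ^ 2 * t / 2) ∂ρ₁ =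
      ∫ t, exp (-α * b t - α ^ 2 * t / 2) ∂ρ₂) {s c : ℝ} (hs : 0 ≤ s) {w : ℂ}
    (hw : |w.im| < w.re) {L : ℝ} (hL : ∀ t > s,
      exp (-w.re * (b t + β * t - c - β * s) - (w.re ^ 2 - w.im ^ 2) * (t - s) / 2) ≤ L) :
    ‖complexMGF (fun y => c - y) (heatPush b ρ₁ s) (β + w) -
      complexMGF (fun y => c - y) (heatPush b ρ₂ s) (β + w)‖ ≤
      exp (β * c + β ^ 2 * s / 2) * (∫ t, exp (-β * b t - β ^ 2 * t / 2) ∂ρ₁ +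
        ∫ t, exp (-β * b t - β ^ 2 * t / 2) ∂ρ₂) * L := by
  rw [complexMGF_heatPush hb (measure_Ioc_lt_top_of_integrable hb hint₁ s),
    complexMGF_heatPush hb (measure_Ioc_lt_top_of_integrable hb hint₂ s)]
  have k₁ := setIntegral_Ioc_add_Ioi hρ₁ hs
    ((integrable_boundaryKernel hb hρ₁ hm hint₁ hw.le).const_mul
      (Complex.exp ((β + w) * c + (β + w) ^ 2 * s / 2)))
  have k₂ := setIntegral_Ioc_add_Ioi hρ₂ hs
    ((integrable_boundaryKernel hb hρ₂ hm hint₂ hw.le).const_mul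
      (Complex.exp ((β + w) * c + (β + w) ^ 2 * s / 2)))
  have htot : ∫ t, Complex.exp ((β + w) * c + (β + w) ^ 2 * s / 2) *
      boundaryKernel b (β + w) t ∂ρ₁ = ∫ t, Complex.exp ((β + w) * c + (β + w) ^ 2 * s / 2) *
      boundaryKernel b (β + w) t ∂ρ₂ := by
    rw [integral_const_mul, integral_const_mul,
      integral_boundaryKernel_eq_of_sector hb hρ₁ hρ₂ hm hint₁ hint₂ heq hw]
  rw [← k₁, ← k₂] at htot
  rw [sub_eq_sub_iff_add_eq_add.2 (htot.trans (add_comm _ _))]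
  refine (norm_sub_le _ _).trans ?_
  exact (add_le_add (norm_setIntegral_Ioi_boundaryKernel_le hint₂ hL)
    (norm_setIntegral_Ioi_boundaryKernel_le hint₁ hL)).trans_eq (by ring)

/-- If the boundary transforms of `ρ₁` and `ρ₂` agree, the heat flow of the parts carried by
`(0,s]` cannot distinguish `ρ₁` from `ρ₂` strictly below the boundary at time `s`. -/
lemma heatPush_restrict_Iio_eq_of_lt {b : ℝ → ℝ} (hb : Continuous b) {ρ₁ ρ₂ : Measure ℝ}
    (hρ₁ : ρ₁ (Iic 0) = 0) (hρ₂ : ρ₂ (Iic 0) = 0) {β m : ℝ} (hβ : 0 ≤ β)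
    (hm : ∀ t ≥ 0, m ≤ b t + β * t)
    (hint₁ : Integrable (fun t => exp (-β * b t - β ^ 2 * t / 2)) ρ₁)
    (hint₂ : Integrable (fun t => exp (-β * b t - β ^ 2 * t / 2)) ρ₂) {A : ℝ}
    (heq : ∀ α ≥ A, ∫ t, exp (-α * b t - α ^ 2 * t / 2) ∂ρ₁ =
      ∫ t, exp (-α * b t - α ^ 2 * t / 2) ∂ρ₂) {s c : ℝ} (hs : 0 ≤ s) (hc : c < b s) :
    (heatPush b ρ₁ s).restrict (Iio c) = (heatPush b ρ₂ s).restrict (Iio c) := by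
  have hf₁ := measure_Ioc_lt_top_of_integrable hb hint₁ s
  have hf₂ := measure_Ioc_lt_top_of_integrable hb hint₂ s
  have := isFiniteMeasure_heatPush (b := b) hf₁
  have := isFiniteMeasure_heatPush (b := b) hf₂
  obtain ⟨B, hB⟩ := (isCompact_Icc (a := (0 : ℝ)) (b := s)).exists_bound_of_continuousOn
    hb.continuousOn
  have hB0 : 0 ≤ B := (norm_nonneg _).trans (hB s ⟨hs, le_rfl⟩)
  obtain ⟨ε, hε, hεb⟩ : ∃ ε > 0, ∀ t, s < t → t ≤ s + ε → c ≤ b t := by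
    obtain ⟨ε, hε, h⟩ := Metric.eventually_nhds_iff.1 (hb.continuousAt.eventually (lt_mem_nhds hc))
    refine ⟨ε / 2, half_pos hε, fun t h1 h2 => (h ?_).le⟩
    rw [Real.dist_eq, abs_of_pos (by linarith)]
    linarith
  set M : ℝ := |m| + |c| + β * s with hM
  have hM0 : 0 ≤ M := by positivity
  have hMt : ∀ t > s, -M ≤ b t + β * t - c - β * s := fun t ht => by
    linarith [hm t (by linarith : t ≥ 0), neg_abs_le m, le_abs_self c]
  set C₁ : ℝ := exp (β * (|c| + B) + β ^ 2 * s / 2) * (ρ₁.real (Ioc 0 s) + ρ₂.real (Ioc 0 s))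
    with hC₁
  set C₂ : ℝ := exp (β * c + β ^ 2 * s / 2) * (∫ t, exp (-β * b t - β ^ 2 * t / 2) ∂ρ₁ +
        ∫ t, exp (-β * b t - β ^ 2 * t / 2) ∂ρ₂) with hC₂
  have hC₁0 : 0 ≤ C₁ := by positivity
  have hC₂0 : 0 ≤ C₂ := mul_nonneg (exp_pos _).le
    (add_nonneg (integral_nonneg fun _ => (exp_pos _).le) (integral_nonneg fun _ => (exp_pos _).le))
  set N : ℝ := exp (M ^ 2 / (2 * ε)) with hN
  have hN1 : 1 ≤ N := one_le_exp (by positivity)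
  have hout : ∀ w : ℂ, 0 ≤ w.re → w.re ≤ |w.im| →
      ‖complexMGF (fun y => c - y) (heatPush b ρ₁ s) (β + w) -
        complexMGF (fun y => c - y) (heatPush b ρ₂ s) (β + w)‖ ≤
        C₁ * exp ((|c| + B + β * s) * ‖w‖) := by
    intro w h1 h2
    refine (norm_sub_le _ _).trans ((add_le_add
      (norm_complexMGF_heatPush_le hb hβ hf₁ c hB h1 h2)
      (norm_complexMGF_heatPush_le hb hβ hf₂ c hB h1 h2)).trans_eq ?_)
    rw [hC₁]
    ring
  refine restrict_Iio_eq_of_norm_complexMGF_sub_le (B := M + (|c| + B + β * s))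
    (C := C₁ + C₂ * N) (integrable_exp_mul_heatPush hb hf₁)
    (integrable_exp_mul_heatPush hb hf₂) hβ (fun w hw => ?_) (fun x hx => ?_)
  · rcases le_or_gt w.re |w.im| with h | h
    · refine (hout w hw h).trans ?_
      refine mul_le_mul (le_add_of_nonneg_right (by positivity)) (exp_le_exp.2 ?_) (exp_pos _).le
        (by positivity)
      exact mul_le_mul_of_nonneg_right (le_add_of_nonneg_left hM0) (norm_nonneg _)
    · refine (norm_complexMGF_heatPush_sub_le hb hρ₁ hρ₂ hm hint₁ hint₂ heq hs h
        (L := exp (M * ‖w‖)) fun t ht => exp_le_exp.2 ?_).trans ?_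
      · have h1 : w.im ^ 2 ≤ w.re ^ 2 := sq_le_sq' (by linarith [neg_abs_le w.im])
          (by linarith [le_abs_self w.im])
        have h2 : 0 ≤ (w.re ^ 2 - w.im ^ 2) * (t - s) :=
          mul_nonneg (by linarith) (by linarith [ht.le])
        have h3 : w.re * -M ≤ w.re * (b t + β * t - c - β * s) :=
          mul_le_mul_of_nonneg_left (hMt t ht) hw
        have h4 : w.re * M ≤ ‖w‖ * M :=
          mul_le_mul_of_nonneg_right ((le_abs_self _).trans (Complex.abs_re_le_norm w)) hM0
        linarith
      · refine mul_le_mul ?_ (exp_le_exp.2 ?_) (exp_pos _).le (by positivity)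
        · rw [← hC₂]
          nlinarith
        · exact mul_le_mul_of_nonneg_right (le_add_of_nonneg_right (by positivity)) (norm_nonneg _)
  · rcases hx.eq_or_lt with rfl | hx
    · refine (hout _ (by simp) (by simp)).trans ?_
      simp only [Complex.ofReal_zero, norm_zero, mul_zero, exp_zero, mul_one]
      exact le_add_of_nonneg_right (by positivity)
    · refine (norm_complexMGF_heatPush_sub_le hb hρ₁ hρ₂ hm hint₁ hint₂ heq hs
        (by simpa using hx) (L := N) fun t ht => ?_).trans (le_add_of_nonneg_left hC₁0)
      simp only [Complex.ofReal_re, Complex.ofReal_im]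
      have hts : 0 < t - s := sub_pos.2 ht
      rcases le_or_gt t (s + ε) with h | h
      · refine (exp_le_one_iff.2 ?_).trans hN1
        have h1 := hεb t ht h
        have h2 : 0 ≤ x * (b t + β * t - c - β * s) :=
          mul_nonneg hx.le (by nlinarith)
        have h3 : 0 ≤ (x ^ 2 - 0 ^ 2) * (t - s) := by
          have := sq_nonneg x
          exact mul_nonneg (by linarith) hts.le
        linarith
      · refine exp_le_exp.2 ?_
        have h1 : x * -M ≤ x * (b t + β * t - c - β * s) :=
          mul_le_mul_of_nonneg_left (hMt t ht) hx.le
        have h2 : x ^ 2 * ε ≤ x ^ 2 * (t - s) :=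
          mul_le_mul_of_nonneg_left (by linarith) (sq_nonneg x)
        have h3 : x * M - x ^ 2 * ε / 2 ≤ M ^ 2 / (2 * ε) := by
          rw [le_div_iff₀ (by positivity)]
          nlinarith [sq_nonneg (x * ε - M)]
        linarith

lemma heatPush_restrict_Iio_eq {b : ℝ → ℝ} (hb : Continuous b) {ρ₁ ρ₂ : Measure ℝ}
    (hρ₁ : ρ₁ (Iic 0) = 0) (hρ₂ : ρ₂ (Iic 0) = 0) {β m : ℝ} (hβ : 0 ≤ β)
    (hm : ∀ t ≥ 0, m ≤ b t + β * t)
    (hint₁ : Integrable (fun t => exp (-β * b t - β ^ 2 * t / 2)) ρ₁)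
    (hint₂ : Integrable (fun t => exp (-β * b t - β ^ 2 * t / 2)) ρ₂) {A : ℝ}
    (heq : ∀ α ≥ A, ∫ t, exp (-α * b t - α ^ 2 * t / 2) ∂ρ₁ =
      ∫ t, exp (-α * b t - α ^ 2 * t / 2) ∂ρ₂) {s : ℝ} (hs : 0 ≤ s) :
    (heatPush b ρ₁ s).restrict (Iio (b s)) = (heatPush b ρ₂ s).restrict (Iio (b s)) := by
  obtain ⟨u, -, hu, hlim⟩ := exists_seq_strictMono_tendsto (b s)
  have hU : Iio (b s) = ⋃ n, Iio (u n) := by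
    ext y
    simp only [mem_Iio, mem_iUnion]
    exact ⟨fun h => (hlim.eventually (lt_mem_nhds h)).exists, fun ⟨n, h⟩ => h.trans (hu n)⟩
  rw [hU, Measure.restrict_iUnion_congr]
  exact fun n => heatPush_restrict_Iio_eq_of_lt hb hρ₁ hρ₂ hβ hm hint₁ hint₂ heq hs (hu n)

/-- The heat semigroup of Brownian motion. -/
noncomputable def heatSemigroup (u : ℝ) (φ : ℝ → ℝ≥0∞) (x : ℝ) : ℝ≥0∞ :=
  ∫⁻ y, φ (x + √u * y) ∂(gaussianReal 0 1)

lemma measurable_heatSemigroup {φ : ℝ → ℝ≥0∞} (hφ : Measurable φ) :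
    Measurable fun p : ℝ × ℝ => heatSemigroup p.1 φ p.2 := by
  unfold heatSemigroup
  exact Measurable.lintegral_prod_right' (f := fun q : (ℝ × ℝ) × ℝ => φ (q.1.2 + √q.1.1 * q.2))
    (by fun_prop)

lemma heatSemigroup_zero (φ : ℝ → ℝ≥0∞) : heatSemigroup 0 φ = φ := by
  ext x
  simp [heatSemigroup]

lemma heatSemigroup_mono {φ ψ : ℝ → ℝ≥0∞} (h : ∀ y, φ y ≤ ψ y) (u x : ℝ) :
    heatSemigroup u φ x ≤ heatSemigroup u ψ x :=
  lintegral_mono fun _ => h _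

lemma heatSemigroup_le_one {φ : ℝ → ℝ≥0∞} (h : ∀ y, φ y ≤ 1) (u x : ℝ) :
    heatSemigroup u φ x ≤ 1 :=
  (lintegral_mono fun _ => h _).trans (by simp)

lemma heatSemigroup_eq_lintegral {φ : ℝ → ℝ≥0∞} (hφ : Measurable φ) {u : ℝ} (hu : 0 ≤ u) (x : ℝ) :
    heatSemigroup u φ x = ∫⁻ v, φ (x + v) ∂(gaussianReal 0 u.toNNReal) := by
  have hv : gaussianReal 0 u.toNNReal = (gaussianReal 0 1).map (√u * ·) := by
    rw [gaussianReal_map_const_mul]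
    congr 1
    · simp
    · ext
      simp [sq_sqrt hu, hu]
  rw [hv, lintegral_map (by fun_prop) (by fun_prop), heatSemigroup]

lemma heatSemigroup_heatSemigroup {φ : ℝ → ℝ≥0∞} (hφ : Measurable φ) {u r : ℝ} (hu : 0 ≤ u)
    (hr : 0 ≤ r) : heatSemigroup u (heatSemigroup r φ) = heatSemigroup (u + r) φ := by
  ext x
  have hm : Measurable (heatSemigroup r φ) :=
    (measurable_heatSemigroup hφ).comp (measurable_const.prodMk measurable_id)
  rw [heatSemigroup_eq_lintegral hm hu, heatSemigroup_eq_lintegral hφ (add_nonneg hu hr)]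
  have hG := gaussianReal_conv_gaussianReal (m₁ := 0) (m₂ := 0) (v₁ := u.toNNReal)
    (v₂ := r.toNNReal)
  rw [add_zero, ← Real.toNNReal_add hu hr] at hG
  rw [← hG, Measure.lintegral_conv (by fun_prop)]
  refine lintegral_congr fun v => ?_
  rw [heatSemigroup_eq_lintegral hφ hr]
  simp_rw [add_assoc]

/-- Total mass seen at time `s`, through a test function, of the heat flow started on the graph
of `b`. -/
noncomputable def heatPairing (b : ℝ → ℝ) (ρ : Measure ℝ) (s : ℝ) (φ : ℝ → ℝ≥0∞) : ℝ≥0∞ :=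
  ∫⁻ t in Ioc 0 s, heatSemigroup (s - t) φ (b t) ∂ρ

lemma measurable_heatSemigroup_sub {b : ℝ → ℝ} (hb : Continuous b) {φ : ℝ → ℝ≥0∞}
    (hφ : Measurable φ) (s : ℝ) : Measurable fun t => heatSemigroup (s - t) φ (b t) :=
  (measurable_heatSemigroup hφ).comp ((measurable_const.sub measurable_id).prodMk hb.measurable)

lemma heatPairing_eq_lintegral_heatPush {b : ℝ → ℝ} (hb : Continuous b) (ρ : Measure ℝ) (s : ℝ)
    {φ : ℝ → ℝ≥0∞} (hφ : Measurable φ) :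
    heatPairing b ρ s φ = ∫⁻ y, φ y ∂(heatPush b ρ s) :=
  (lintegral_heatPush hb ρ s hφ).symm

lemma heatPairing_eq_of_restrict_Iio_eq {b : ℝ → ℝ} (hb : Continuous b) {ρ₁ ρ₂ : Measure ℝ}
    {s : ℝ} (h : (heatPush b ρ₁ s).restrict (Iio (b s)) = (heatPush b ρ₂ s).restrict (Iio (b s)))
    {φ : ℝ → ℝ≥0∞} (hφ : Measurable φ) (hφ0 : ∀ y, b s ≤ y → φ y = 0) :
    heatPairing b ρ₁ s φ = heatPairing b ρ₂ s φ := by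
  have hind : (Iio (b s)).indicator φ = φ := by
    rw [indicator_eq_self]
    intro y hy
    by_contra hy'
    exact hy (hφ0 y (not_lt.1 hy'))
  rw [heatPairing_eq_lintegral_heatPush hb _ _ hφ, heatPairing_eq_lintegral_heatPush hb _ _ hφ,
    ← hind, lintegral_indicator measurableSet_Iio, lintegral_indicator measurableSet_Iio, h]

lemma heatPairing_add {b : ℝ → ℝ} (hb : Continuous b) (ρ : Measure ℝ) (s : ℝ)
    {φ ψ : ℝ → ℝ≥0∞} (hφ : Measurable φ) (hψ : Measurable ψ) :
    heatPairing b ρ s (fun y => φ y + ψ y) = heatPairing b ρ s φ + heatPairing b ρ s ψ := by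
  rw [heatPairing_eq_lintegral_heatPush hb _ _ (show Measurable fun y => φ y + ψ y from hφ.add hψ),
    lintegral_add_left hφ,
    heatPairing_eq_lintegral_heatPush hb _ _ hφ, heatPairing_eq_lintegral_heatPush hb _ _ hψ]

/-- Transporting a test function backwards in time. -/
lemma heatPairing_eq_add {b : ℝ → ℝ} (ρ : Measure ℝ) {s₀ s : ℝ}
    (h0 : 0 ≤ s₀) (hs : s₀ ≤ s) {φ : ℝ → ℝ≥0∞} (hφ : Measurable φ) :
    heatPairing b ρ s φ = heatPairing b ρ s₀ (heatSemigroup (s - s₀) φ) +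
      ∫⁻ t in Ioc s₀ s, heatSemigroup (s - t) φ (b t) ∂ρ := by
  rw [heatPairing, ← Ioc_union_Ioc_eq_Ioc h0 hs,
    lintegral_union measurableSet_Ioc (Ioc_disjoint_Ioc_of_le le_rfl), heatPairing]
  congr 1
  refine setLIntegral_congr_fun measurableSet_Ioc fun t ht => ?_
  rw [heatSemigroup_heatSemigroup hφ (by linarith [ht.2]) (by linarith)]
  congr 1
  ring

/-- A test function on `{s} × ℝ ∪ (s,T]` which does not distinguish `ρ₁` from `ρ₂` and dominates
the probability of lying below the boundary at each time of `F`. -/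
def HasDominatingTest (b : ℝ → ℝ) (ρ₁ ρ₂ : Measure ℝ) (T s : ℝ) (F : Finset ℝ) : Prop :=
  ∃ v w : ℝ → ℝ≥0∞, Measurable v ∧ Measurable w ∧ (∀ y, v y ≤ 1) ∧ (∀ t, w t ≤ 1) ∧
    heatPairing b ρ₁ s v + ∫⁻ t in Ioc s T, w t ∂ρ₁ =
      heatPairing b ρ₂ s v + ∫⁻ t in Ioc s T, w t ∂ρ₂ ∧
    (∀ r ∈ F, ∀ y, heatSemigroup (r - s) ((Iio (b r)).indicator 1) y ≤ v y) ∧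
    ∀ r ∈ F, ∀ t, s < t → t < r → heatSemigroup (r - t) ((Iio (b r)).indicator 1) (b t) ≤ w t

lemma HasDominatingTest.of_le {b : ℝ → ℝ} (hb : Continuous b) {ρ₁ ρ₂ : Measure ℝ} {T s s₀ : ℝ}
    {F : Finset ℝ} (h : HasDominatingTest b ρ₁ ρ₂ T s F) (h0 : 0 ≤ s₀) (hs : s₀ ≤ s) (hsT : s ≤ T)
    (hF : ∀ r ∈ F, s ≤ r) : HasDominatingTest b ρ₁ ρ₂ T s₀ F := by
  obtain ⟨v, w, hv, hw, hv1, hw1, heq, hFv, hFw⟩ := h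
  have hm := measurable_heatSemigroup_sub hb hv s
  have hsplit : ∀ ρ : Measure ℝ, heatPairing b ρ s₀ (heatSemigroup (s - s₀) v) +
      ∫⁻ t in Ioc s₀ T, (Iic s).piecewise (fun t => heatSemigroup (s - t) v (b t)) w t ∂ρ =
      heatPairing b ρ s v + ∫⁻ t in Ioc s T, w t ∂ρ := by
    intro ρ
    rw [heatPairing_eq_add ρ h0 hs hv, ← Ioc_union_Ioc_eq_Ioc hs hsT,
      lintegral_union measurableSet_Ioc (Ioc_disjoint_Ioc_of_le le_rfl), add_assoc]
    congr 2
    · refine setLIntegral_congr_fun measurableSet_Ioc fun t ht => ?_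
      exact piecewise_eq_of_mem _ _ _ ht.2
    · refine setLIntegral_congr_fun measurableSet_Ioc fun t ht => ?_
      exact piecewise_eq_of_notMem _ _ _ (not_le.2 ht.1)
  have hind : ∀ r : ℝ, Measurable ((Iio (b r)).indicator (1 : ℝ → ℝ≥0∞)) :=
    fun r => measurable_one.indicator measurableSet_Iio
  refine ⟨heatSemigroup (s - s₀) v, (Iic s).piecewise (fun t => heatSemigroup (s - t) v (b t)) w,
    (measurable_heatSemigroup hv).comp (measurable_const.prodMk measurable_id),
    hm.piecewise measurableSet_Iic hw, heatSemigroup_le_one hv1 _, fun t => ?_,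
    by rw [hsplit, hsplit, heq], fun r hr y => ?_, fun r hr t ht htr => ?_⟩
  · by_cases ht : t ∈ Iic s
    · rw [piecewise_eq_of_mem _ _ _ ht]
      exact heatSemigroup_le_one hv1 _ _
    · rw [piecewise_eq_of_notMem _ _ _ ht]
      exact hw1 t
  · have e : r - s₀ = (s - s₀) + (r - s) := by ring
    rw [e, ← heatSemigroup_heatSemigroup (hind r) (by linarith) (by linarith [hF r hr])]
    exact heatSemigroup_mono (hFv r hr) _ _
  · by_cases hts : t ∈ Iic s
    · rw [piecewise_eq_of_mem _ _ _ hts]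
      have hts' : t ≤ s := hts
      have e : r - t = (s - t) + (r - s) := by ring
      rw [e, ← heatSemigroup_heatSemigroup (hind r) (by linarith) (by linarith [hF r hr])]
      exact heatSemigroup_mono (hFv r hr) _ _
    · rw [piecewise_eq_of_notMem _ _ _ hts]
      exact hFw r hr t (not_le.1 hts) htr

lemma HasDominatingTest.insert_self {b : ℝ → ℝ} (hb : Continuous b) {ρ₁ ρ₂ : Measure ℝ} {T s : ℝ}
    {F : Finset ℝ} (h : HasDominatingTest b ρ₁ ρ₂ T s F)
    (hs : (heatPush b ρ₁ s).restrict (Iio (b s)) = (heatPush b ρ₂ s).restrict (Iio (b s))) :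
    HasDominatingTest b ρ₁ ρ₂ T s (insert s F) := by
  obtain ⟨v, w, hv, hw, hv1, hw1, heq, hFv, hFw⟩ := h
  set φ : ℝ → ℝ≥0∞ := (Iio (b s)).indicator fun y => 1 - v y with hφdef
  have hφ : Measurable φ := (measurable_const.sub hv).indicator measurableSet_Iio
  have hφ1 : ∀ y, y < b s → v y + φ y = 1 := fun y hy => by
    rw [hφdef, indicator_of_mem (show y ∈ Iio (b s) from hy)]
    exact add_tsub_cancel_of_le (hv1 y)
  have hφ0 : ∀ y, b s ≤ y → φ y = 0 := fun y hy =>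
    indicator_of_notMem (show y ∉ Iio (b s) from not_lt.2 hy) _
  refine ⟨fun y => v y + φ y, w, hv.add hφ, hw, fun y => ?_, hw1, ?_, fun r hr y => ?_,
    fun r hr t ht htr => ?_⟩
  · rcases lt_or_ge y (b s) with h | h
    · exact (hφ1 y h).le
    · simpa [hφ0 y h] using hv1 y
  · rw [heatPairing_add hb _ _ hv hφ, heatPairing_add hb _ _ hv hφ, add_right_comm, heq,
      heatPairing_eq_of_restrict_Iio_eq hb hs hφ hφ0, add_right_comm]
  · rcases Finset.mem_insert.1 hr with rfl | hr
    · rw [sub_self, heatSemigroup_zero]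
      by_cases hy : y ∈ Iio (b r)
      · rw [indicator_of_mem hy]
        exact (hφ1 y hy).ge
      · rw [indicator_of_notMem hy]
        exact zero_le
    · exact (hFv r hr y).trans le_self_add
  · rcases Finset.mem_insert.1 hr with rfl | hr
    · exact absurd ht htr.not_gt
    · exact hFw r hr t ht htr

lemma hasDominatingTest {b : ℝ → ℝ} (hb : Continuous b) {ρ₁ ρ₂ : Measure ℝ}
    (h : ∀ s ≥ 0, (heatPush b ρ₁ s).restrict (Iio (b s)) = (heatPush b ρ₂ s).restrict (Iio (b s)))
    {T : ℝ} (F : Finset ℝ) : ∀ s, 0 ≤ s → s ≤ T → (∀ r ∈ F, s ≤ r ∧ r ≤ T) →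
      HasDominatingTest b ρ₁ ρ₂ T s F := by
  induction F using Finset.induction_on_min with
  | empty =>
    intro s _ _ _
    refine ⟨0, 0, measurable_zero, measurable_zero, by simp, by simp, ?_, by simp, by simp⟩
    simp [heatPairing, heatSemigroup]
  | insert a F haF ih =>
    intro s hs hsT hF
    have ha := hF a (Finset.mem_insert_self a F)
    have h1 := ih a (hs.trans ha.1) ha.2 fun r hr =>
      ⟨(haF r hr).le, (hF r (Finset.mem_insert_of_mem hr)).2⟩
    refine (h1.insert_self hb (h a (hs.trans ha.1))).of_le hb hs ha.1 ha.2 fun r hr => ?_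
    rcases Finset.mem_insert.1 hr with rfl | hr
    · exact le_rfl
    · exact (haF r hr).le

lemma exists_dominatingTest {b : ℝ → ℝ} (hb : Continuous b) {ρ₁ ρ₂ : Measure ℝ}
    (h : ∀ s ≥ 0, (heatPush b ρ₁ s).restrict (Iio (b s)) = (heatPush b ρ₂ s).restrict (Iio (b s)))
    {T : ℝ} (hT : 0 ≤ T) (F : Finset ℝ) (hF : ∀ r ∈ F, 0 ≤ r ∧ r ≤ T) :
    ∃ w : ℝ → ℝ≥0∞, Measurable w ∧ (∀ t, w t ≤ 1) ∧
      ∫⁻ t in Ioc 0 T, w t ∂ρ₁ = ∫⁻ t in Ioc 0 T, w t ∂ρ₂ ∧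
      ∀ r ∈ F, ∀ t, 0 < t → t < r →
        heatSemigroup (r - t) ((Iio (b r)).indicator 1) (b t) ≤ w t := by
  obtain ⟨v, w, -, hw, -, hw1, heq, -, hFw⟩ := hasDominatingTest hb h F 0 le_rfl hT hF
  exact ⟨w, hw, hw1, by simpa [heatPairing] using heq, hFw⟩

/-- A set along which `b` decreases at least like a square root is Lebesgue null. -/
lemma volume_eq_zero_of_sqrt_decrease {b : ℝ → ℝ} {B : Set ℝ}
    (h : ∀ t ∈ B, ∀ s ∈ B, t < s → b s ≤ b t - 2 * √(s - t)) : volume B = 0 := by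
  have key : ∀ t ∈ B, ∀ s ∈ B, |t - s| ≤ |b t - b s| ^ 2 := by
    have aux : ∀ t ∈ B, ∀ s ∈ B, t < s → |t - s| ≤ |b t - b s| ^ 2 := fun t ht s hs hts => by
      have h1 := h t ht s hs hts
      have h2 : √(s - t) ^ 2 = s - t := sq_sqrt (by linarith)
      have h3 : √(s - t) ≤ b t - b s := by linarith [sqrt_nonneg (s - t)]
      rw [abs_sub_comm, abs_of_pos (sub_pos.2 hts), sq_abs, ← h2]
      exact pow_le_pow_left₀ (sqrt_nonneg _) h3 2
    intro t ht s hs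
    rcases lt_trichotomy t s with hts | rfl | hts
    · exact aux t ht s hs hts
    · simp
    · rw [abs_sub_comm t, abs_sub_comm (b t)]
      exact aux s hs t ht hts
  have hinj : InjOn b B := fun t ht s hs hts => by
    have := key t ht s hs
    rw [hts, sub_self, abs_zero, zero_pow two_ne_zero] at this
    exact sub_eq_zero.1 (abs_nonpos_iff.1 this)
  have hH : HolderOnWith 1 2 (Function.invFunOn b B) (b '' B) := by
    rintro _ ⟨t, ht, rfl⟩ _ ⟨s, hs, rfl⟩
    rw [hinj.leftInvOn_invFunOn ht, hinj.leftInvOn_invFunOn hs, edist_dist, edist_dist,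
      ENNReal.ofReal_rpow_of_nonneg dist_nonneg (by positivity), ENNReal.coe_one, one_mul]
    refine ENNReal.ofReal_le_ofReal ?_
    simpa [Real.dist_eq] using key t ht s hs
  have hdim : dimH B < 1 := by
    have h1 := hH.dimH_image_le two_pos
    rw [hinj.invFunOn_image Subset.rfl] at h1
    have h2 : dimH (b '' B) ≤ 1 := Real.dimH_univ ▸ dimH_mono (subset_univ _)
    calc dimH B ≤ dimH (b '' B) / (2 : ℝ≥0) := h1
      _ ≤ 1 / (2 : ℝ≥0) := by gcongr
      _ < 1 := by
        rw [one_div]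
        exact ENNReal.inv_lt_one.2 (by norm_num)
  exact measure_zero_of_dimH_lt (d := 1) (by simp [hausdorffMeasure_real]; rfl)
    (by simpa using hdim)

lemma gaussianReal_Iio_pos (c : ℝ) : 0 < gaussianReal 0 1 (Iio c) := by
  rw [pos_iff_ne_zero]
  intro h
  have h1 := gaussianReal_absolutelyContinuous' 0 (one_ne_zero : (1 : ℝ≥0) ≠ 0) h
  simp at h1

lemma gaussianReal_le_heatSemigroup {b c u : ℝ} (h : b - 2 * √u < c) :
    gaussianReal 0 1 (Iio (-2)) ≤ heatSemigroup u ((Iio c).indicator 1) b := by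
  rw [heatSemigroup, ← lintegral_indicator_one measurableSet_Iio]
  refine lintegral_mono fun y => ?_
  by_cases hy : y ∈ Iio (-2 : ℝ)
  · have hy' : b + √u * y ∈ Iio c := by
      have : y < -2 := hy
      have := mul_le_mul_of_nonneg_left this.le (sqrt_nonneg u)
      simp only [mem_Iio]
      linarith
    rw [indicator_of_mem hy']
    exact indicator_le_self _ _ _
  · simp [indicator_of_notMem hy]

lemma mul_measure_Ioo_le {b : ℝ → ℝ} (hb : Continuous b) {ρ₁ ρ₂ : Measure ℝ}
    (hρ₂ : ρ₂ ≪ volume)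
    (h : ∀ s ≥ 0, (heatPush b ρ₁ s).restrict (Iio (b s)) = (heatPush b ρ₂ s).restrict (Iio (b s)))
    {T : ℝ} (hT : 0 ≤ T) :
    gaussianReal 0 1 (Iio (-2)) * ρ₂ (Ioo 0 T) ≤ ρ₁ univ := by
  classical
  set κ := gaussianReal 0 1 (Iio (-2))
  let F : ℕ → Finset ℝ := fun n =>
    ((Finset.range n).image (TopologicalSpace.denseSeq ℝ)).filter (· ∈ Ioo 0 T)
  let A : ℕ → Set ℝ := fun n =>
    {t | t ∈ Ioo 0 T ∧ ∃ s ∈ F n, t < s ∧ b t - 2 * √(s - t) < b s}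
  have hAκ : ∀ n, κ * ρ₂ (A n) ≤ ρ₁ univ := by
    intro n
    obtain ⟨w, hw, hw1, heq, hFw⟩ := exists_dominatingTest hb h hT (F n) fun r hr =>
      ⟨(Finset.mem_filter.1 hr).2.1.le, (Finset.mem_filter.1 hr).2.2.le⟩
    have hAw : A n ⊆ {t | κ ≤ w t} ∩ Ioc 0 T := by
      rintro t ⟨ht, s, hs, hts, hbs⟩
      exact ⟨(gaussianReal_le_heatSemigroup hbs).trans (hFw s hs t ht.1 hts),
        Ioo_subset_Ioc_self ht⟩
    calc κ * ρ₂ (A n) ≤ κ * (ρ₂.restrict (Ioc 0 T)) {t | κ ≤ w t} := by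
          rw [Measure.restrict_apply (measurableSet_le measurable_const hw)]
          gcongr
      _ ≤ ∫⁻ t in Ioc 0 T, w t ∂ρ₂ := mul_meas_ge_le_lintegral hw κ
      _ = ∫⁻ t in Ioc 0 T, w t ∂ρ₁ := heq.symm
      _ ≤ ∫⁻ t in Ioc 0 T, 1 ∂ρ₁ := lintegral_mono hw1
      _ ≤ ρ₁ univ := by
        simpa using measure_mono (subset_univ _)
  have hAmono : Monotone A := by
    rintro m n hmn t ⟨ht, s, hs, hts⟩
    refine ⟨ht, s, ?_, hts⟩
    exact Finset.filter_subset_filter _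
      (Finset.image_subset_image (Finset.range_mono hmn)) hs
  have hnull : ρ₂ (Ioo 0 T \ ⋃ n, A n) = 0 := by
    refine hρ₂ (volume_eq_zero_of_sqrt_decrease (b := b) fun t ht s hs hts => ?_)
    by_contra! hlt
    have hopen : IsOpen {x | x ∈ Ioo t T ∧ b t - 2 * √(x - t) < b x} :=
      isOpen_Ioo.inter (isOpen_lt (by fun_prop) hb)
    obtain ⟨k, hx, hxb⟩ := (TopologicalSpace.denseRange_denseSeq ℝ).exists_mem_open hopen
      ⟨s, ⟨hts, hs.1.2⟩, hlt⟩
    refine ht.2 (mem_iUnion.2 ⟨k + 1, ht.1, _, ?_, hx.1, hxb⟩)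
    exact Finset.mem_filter.2 ⟨Finset.mem_image_of_mem _ (by simp), ht.1.1.trans hx.1, hx.2⟩
  have hle : ρ₂ (Ioo 0 T) ≤ ⨆ n, ρ₂ (A n) := by
    rw [← hAmono.measure_iUnion]
    calc ρ₂ (Ioo 0 T) ≤ ρ₂ ((⋃ n, A n) ∪ Ioo 0 T \ ⋃ n, A n) :=
          measure_mono (by rw [union_sdiff_self]; exact subset_union_right)
      _ ≤ ρ₂ (⋃ n, A n) := (measure_union_le _ _).trans (by rw [hnull, add_zero])
  calc κ * ρ₂ (Ioo 0 T) ≤ κ * ⨆ n, ρ₂ (A n) := by gcongr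
    _ = ⨆ n, κ * ρ₂ (A n) := ENNReal.mul_iSup _ _
    _ ≤ ρ₁ univ := iSup_le hAκ

lemma isFiniteMeasure_of_heatPush_eq {b : ℝ → ℝ} (hb : Continuous b) {ρ₁ ρ₂ : Measure ℝ}
    [IsFiniteMeasure ρ₁] (hρ₂ : ρ₂ ≪ volume) (hρ₂' : ρ₂ (Iic 0) = 0)
    (h : ∀ s ≥ 0, (heatPush b ρ₁ s).restrict (Iio (b s)) = (heatPush b ρ₂ s).restrict (Iio (b s))) :
    IsFiniteMeasure ρ₂ := by
  set κ := gaussianReal 0 1 (Iio (-2))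
  have hmono : Monotone fun n : ℕ => Ioo (0 : ℝ) n :=
    fun m n hmn => Ioo_subset_Ioo_right (by exact_mod_cast hmn)
  have hU : ⋃ n : ℕ, Ioo (0 : ℝ) n = Ioi 0 := by
    ext t
    simp only [mem_iUnion, mem_Ioo, mem_Ioi]
    exact ⟨fun ⟨_, h⟩ => h.1, fun ht => (exists_nat_gt t).imp fun _ hn => ⟨ht, hn⟩⟩
  have hle : κ * ρ₂ (Ioi 0) ≤ ρ₁ univ := by
    rw [← hU, hmono.measure_iUnion, ENNReal.mul_iSup]
    exact iSup_le fun n => mul_measure_Ioo_le hb hρ₂ h n.cast_nonneg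
  have hfin : ρ₂ (Ioi 0) < ∞ := by
    by_contra! htop
    rw [top_le_iff.1 htop, ENNReal.mul_top (gaussianReal_Iio_pos _).ne'] at hle
    exact (measure_lt_top ρ₁ univ).not_ge hle
  refine ⟨?_⟩
  rw [← Iic_union_Ioi (a := (0 : ℝ))]
  exact (measure_union_le _ _).trans_lt (by simpa [hρ₂'] using hfin)

lemma CompletelyMonotoneOn.exists_measure {r : ℝ → ℝ} (hr : CompletelyMonotoneOn r)
    (h1 : 0 < r 1) : ∃ q : Measure ℝ, SFinite q ∧ q (Iio 0) = 0 ∧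
      ∀ α > 1, ∫⁻ x, ENNReal.ofReal (exp (-α * x)) ∂q = ENNReal.ofReal (r α) := by
  have hd : ∀ n : ℕ, ∀ u > 0,
      HasDerivAt (fun u => (-1 : ℝ) ^ n * iteratedDerivWithin n r (Ioi 0) u)
        (-((-1 : ℝ) ^ (n + 1) * iteratedDerivWithin (n + 1) r (Ioi 0) u)) u := by
    intro n u hu
    have h := (hr.1.differentiableOn_iteratedDerivWithin (m := n)
      (by exact_mod_cast WithTop.coe_lt_top n) (uniqueDiffOn_Ioi 0) u hu).hasDerivWithinAt
    rw [← iteratedDerivWithin_succ] at h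
    refine ((h.hasDerivAt (Ioi_mem_nhds hu)).const_mul ((-1) ^ n)).congr_deriv ?_
    ring
  simpa using exists_measure_lintegral_exp_of_completelyMonotone
    (d := fun n u => (-1 : ℝ) ^ n * iteratedDerivWithin n r (Ioi 0) u) hd
    (fun n u hu => hr.2 n u hu) (by simpa using h1)

lemma integrable_exp_boundary {b : ℝ → ℝ} (hb : Continuous b)
    (hbdd : ∀ α > (0 : ℝ), ∃ m : ℝ, ∀ t ≥ 0, m ≤ b t + α * t) {ρ : Measure ℝ} [IsFiniteMeasure ρ]
    (hρ : ρ (Iic 0) = 0) {α : ℝ} (hα : 0 < α) :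
    Integrable (fun t => exp (-α * b t - α ^ 2 * t / 2)) ρ := by
  obtain ⟨m, hm⟩ := hbdd (α / 2) (by positivity)
  refine (integrable_const (exp (-α * m))).mono'
    (by fun_prop : Continuous _).aestronglyMeasurable ?_
  filter_upwards [measure_eq_zero_iff_ae_notMem.1 hρ] with t ht
  rw [Real.norm_of_nonneg (exp_pos _).le]
  refine exp_le_exp.2 ?_
  nlinarith [hm t (not_le.1 ht).le]

lemma integral_exp_boundary_eq {b : ℝ → ℝ} (hb : Continuous b)
    (hbdd : ∀ α > (0 : ℝ), ∃ m : ℝ, ∀ t ≥ 0, m ≤ b t + α * t) {ρ₁ ρ₂ : Measure ℝ}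
    [IsFiniteMeasure ρ₁] [IsFiniteMeasure ρ₂] (hρ₁ : ρ₁ (Iic 0) = 0) (hρ₂ : ρ₂ (Iic 0) = 0) {A : ℝ}
    (heq : ∀ α ≥ A, ∫ t, exp (-α * b t - α ^ 2 * t / 2) ∂ρ₁ =
      ∫ t, exp (-α * b t - α ^ 2 * t / 2) ∂ρ₂) {α : ℝ} (hα : 0 < α) :
    ∫ t, exp (-α * b t - α ^ 2 * t / 2) ∂ρ₁ = ∫ t, exp (-α * b t - α ^ 2 * t / 2) ∂ρ₂ := by
  obtain ⟨m, hm⟩ := hbdd (α / 2) (by positivity)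
  have h := integral_boundaryKernel_eq_of_sector hb hρ₁ hρ₂ hm
    (integrable_exp_boundary hb hbdd hρ₁ (half_pos hα))
    (integrable_exp_boundary hb hbdd hρ₂ (half_pos hα)) heq (w := ((α / 2 : ℝ) : ℂ))
    (by simpa using hα)
  rw [← Complex.ofReal_add, add_halves] at h
  simp_rw [boundaryKernel_ofReal] at h
  rw [integral_complex_ofReal, integral_complex_ofReal] at h
  exact_mod_cast h

/-- The density of a mixture over `q` of the densities `K · x`. -/
noncomputable def mixtureDensity (K : ℝ → ℝ → ℝ) (q : Measure ℝ) (t : ℝ) : ℝ≥0∞ :=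
  ∫⁻ x, ENNReal.ofReal (K t x) ∂q

lemma measurable_mixtureDensity {K : ℝ → ℝ → ℝ} (hK : Measurable (Function.uncurry K))
    (q : Measure ℝ) [SFinite q] : Measurable (mixtureDensity K q) :=
  Measurable.lintegral_prod_right' (f := fun p : ℝ × ℝ => ENNReal.ofReal (Function.uncurry K p))
    hK.ennreal_ofReal

lemma lintegral_withDensity_mixtureDensity {K : ℝ → ℝ → ℝ} (hK : Measurable (Function.uncurry K))
    (hK0 : ∀ t ∈ Ioi (0 : ℝ), ∀ x ∈ Ici (0 : ℝ), 0 ≤ K t x) {q : Measure ℝ} [SFinite q]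
    (hq : q (Iio 0) = 0) {e c : ℝ → ℝ} (he : Measurable e) (he0 : ∀ t, 0 ≤ e t)
    (h : ∀ x ∈ Ici (0 : ℝ), ∫ t in Ioi (0 : ℝ), e t * K t x = c x) (hc : ∀ x, 0 < c x) :
    ∫⁻ t, ENNReal.ofReal (e t) ∂((volume.restrict (Ioi 0)).withDensity (mixtureDensity K q)) =
      ∫⁻ x, ENNReal.ofReal (c x) ∂q := by
  rw [lintegral_withDensity_eq_lintegral_mul _ (measurable_mixtureDensity hK q) he.ennreal_ofReal]
  simp only [Pi.mul_apply, mixtureDensity]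
  have hsec : ∀ t, Measurable (K t) := fun t => hK.comp measurable_prodMk_left
  have hmul : ∀ t, (∫⁻ x, ENNReal.ofReal (K t x) ∂q) * ENNReal.ofReal (e t) =
      ∫⁻ x, ENNReal.ofReal (K t x) * ENNReal.ofReal (e t) ∂q :=
    fun t => (lintegral_mul_const _ (hsec t).ennreal_ofReal).symm
  simp_rw [hmul]
  rw [lintegral_lintegral_swap]
  · refine lintegral_congr_ae ?_
    filter_upwards [measure_eq_zero_iff_ae_notMem.1 hq] with x hx
    have hx0 : x ∈ Ici (0 : ℝ) := mem_Ici.2 (not_lt.1 hx)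
    have hi : IntegrableOn (fun t => e t * K t x) (Ioi 0) :=
      Integrable.of_integral_ne_zero (by rw [h x hx0]; exact (hc x).ne')
    rw [← h x hx0, ofReal_integral_eq_lintegral_ofReal hi]
    · refine lintegral_congr fun t => ?_
      rw [ENNReal.ofReal_mul (he0 t), mul_comm]
    · filter_upwards [ae_restrict_mem measurableSet_Ioi] with t ht
      exact mul_nonneg (he0 t) (hK0 t ht x hx0)
  · exact (hK.ennreal_ofReal.mul (he.ennreal_ofReal.comp measurable_fst)).aemeasurable

lemma integral_withDensity_mixtureDensity {K : ℝ → ℝ → ℝ} (hK : Measurable (Function.uncurry K))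
    (hK0 : ∀ t ∈ Ioi (0 : ℝ), ∀ x ∈ Ici (0 : ℝ), 0 ≤ K t x) {q : Measure ℝ} [SFinite q]
    (hq : q (Iio 0) = 0) {e c : ℝ → ℝ} (he : Measurable e) (he0 : ∀ t, 0 ≤ e t)
    (h : ∀ x ∈ Ici (0 : ℝ), ∫ t in Ioi (0 : ℝ), e t * K t x = c x) (hc : ∀ x, 0 < c x)
    (hcm : Measurable c) :
    ∫ t, e t ∂((volume.restrict (Ioi 0)).withDensity (mixtureDensity K q)) = ∫ x, c x ∂q := by
  rw [integral_eq_lintegral_of_nonneg_ae (ae_of_all _ he0) he.aestronglyMeasurable,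
    integral_eq_lintegral_of_nonneg_ae (ae_of_all _ fun x => (hc x).le) hcm.aestronglyMeasurable,
    lintegral_withDensity_mixtureDensity hK hK0 hq he he0 h hc]

lemma withDensity_Ioi_apply_Iic (g : ℝ → ℝ≥0∞) :
    ((volume.restrict (Ioi 0)).withDensity g) (Iic 0) = 0 :=
  withDensity_absolutelyContinuous _ _ (by
    rw [Measure.restrict_apply measurableSet_Iic, Iic_inter_Ioi, Ioc_self, measure_empty])

lemma rfpt_existence_of_continuous {b : ℝ → ℝ} (hb : Continuous b)
    (hbdd : ∀ α > (0 : ℝ), ∃ m : ℝ, ∀ t ≥ 0, m ≤ b t + α * t)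
    {K : ℝ → ℝ → ℝ} (hKmeas : Measurable (Function.uncurry K))
    (hKnonneg : ∀ t ∈ Ioi (0 : ℝ), ∀ x ∈ Ici (0 : ℝ), 0 ≤ K t x)
    (hK : ∀ α > (0 : ℝ), ∀ x ∈ Ici (0 : ℝ),
      ∫ t in Ioi (0 : ℝ), exp (-α * b t - α ^ 2 * t / 2) * K t x = exp (-α * x))
    (hKdens : ∀ x ∈ Ici (0 : ℝ), ∫ t in Ioi (0 : ℝ), K t x = 1)
    {f : ℝ → ℝ} (hfmeas : Measurable f) (hfnonneg : ∀ t ∈ Ioi (0 : ℝ), 0 ≤ f t)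
    (hfint : ∫ t in Ioi (0 : ℝ), f t = 1)
    (hCM : CompletelyMonotoneOn
      (fun α => ∫ t in Ioi (0 : ℝ), exp (-α * b t - α ^ 2 * t / 2) * f t))
    (hinj : ∀ z : ℝ → ℝ, IntegrableOn z (Ioi 0) →
      (∀ α > (0 : ℝ), ∫ t in Ioi (0 : ℝ), exp (-α * b t - α ^ 2 * t / 2) * z t = 0) →
      ∀ᵐ t ∂(volume.restrict (Ioi (0 : ℝ))), z t = 0) :
    ∃ q : Measure ℝ, IsProbabilityMeasure q ∧ q (Iio 0) = 0 ∧
      (∀ α > (0 : ℝ), ∫ x, exp (-α * x) ∂q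
          = ∫ t in Ioi (0 : ℝ), exp (-α * b t - α ^ 2 * t / 2) * f t) ∧
      ∀ᵐ t ∂(volume.restrict (Ioi (0 : ℝ))), ∫ x, K t x ∂q = f t := by
  set ρ₁ : Measure ℝ := (volume.restrict (Ioi 0)).withDensity fun t => ENNReal.ofReal (f t)
    with hρ₁def
  have hf0 : ∀ᵐ t ∂(volume.restrict (Ioi (0 : ℝ))), 0 ≤ f t := by
    filter_upwards [ae_restrict_mem measurableSet_Ioi] with t ht using hfnonneg t ht
  have hfi : IntegrableOn f (Ioi 0) :=
    Integrable.of_integral_ne_zero (by rw [hfint]; exact one_ne_zero)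
  have hf1 : ∫⁻ t in Ioi (0 : ℝ), ENNReal.ofReal (f t) = 1 := by
    rw [← ofReal_integral_eq_lintegral_ofReal hfi hf0, hfint, ENNReal.ofReal_one]
  have : IsProbabilityMeasure ρ₁ := ⟨by
    rw [hρ₁def, withDensity_apply _ MeasurableSet.univ, Measure.restrict_univ, hf1]⟩
  have hρ₁ : ρ₁ (Iic 0) = 0 := withDensity_Ioi_apply_Iic _
  have hem : ∀ α : ℝ, Measurable fun t => exp (-α * b t - α ^ 2 * t / 2) :=
    fun α => (by fun_prop : Continuous _).measurable
  have hr : ∀ α : ℝ, ∫ t in Ioi (0 : ℝ), exp (-α * b t - α ^ 2 * t / 2) * f t =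
      ∫ t, exp (-α * b t - α ^ 2 * t / 2) ∂ρ₁ := by
    intro α
    rw [integral_withDensity_eq_integral_toReal_smul hfmeas.ennreal_ofReal (by simp)]
    refine integral_congr_ae ?_
    filter_upwards [hf0] with t ht
    rw [ENNReal.toReal_ofReal ht, smul_eq_mul, mul_comm]
  obtain ⟨q, hqs, hq0, hq⟩ := hCM.exists_measure (by
    rw [hr]
    exact integral_exp_pos (integrable_exp_boundary hb hbdd hρ₁ one_pos))
  set g := mixtureDensity K q
  set ρ₂ : Measure ℝ := (volume.restrict (Ioi 0)).withDensity g with hρ₂def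
  have hρ₂ : ρ₂ (Iic 0) = 0 := withDensity_Ioi_apply_Iic _
  have hgm : Measurable g := measurable_mixtureDensity hKmeas q
  have htrans : ∀ α > 0, ∫ t, exp (-α * b t - α ^ 2 * t / 2) ∂ρ₂ = ∫ x, exp (-α * x) ∂q :=
    fun α hα => integral_withDensity_mixtureDensity hKmeas hKnonneg hq0 (hem α)
      (fun _ => (exp_pos _).le) (hK α hα) (fun _ => exp_pos _) (by fun_prop)
  have heq : ∀ α ≥ 2, ∫ t, exp (-α * b t - α ^ 2 * t / 2) ∂ρ₁ =
      ∫ t, exp (-α * b t - α ^ 2 * t / 2) ∂ρ₂ := by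
    intro α hα
    rw [htrans α (by linarith), integral_eq_lintegral_of_nonneg_ae (f := fun x => exp (-α * x))
      (ae_of_all _ fun _ => (exp_pos _).le) (by fun_prop), hq α (by linarith), hr,
      ENNReal.toReal_ofReal (integral_nonneg fun _ => (exp_pos _).le)]
  have hint₂ : Integrable (fun t => exp (-2 * b t - 2 ^ 2 * t / 2)) ρ₂ := by
    refine ⟨(hem 2).aestronglyMeasurable, ?_⟩
    rw [hasFiniteIntegral_iff_ofReal (ae_of_all _ fun _ => (exp_pos _).le),
      lintegral_withDensity_mixtureDensity hKmeas hKnonneg hq0 (hem 2)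
        (fun _ => (exp_pos _).le) (hK 2 two_pos) (fun _ => exp_pos _), hq 2 one_lt_two]
    exact ENNReal.ofReal_lt_top
  obtain ⟨m, hm⟩ := hbdd 2 two_pos
  have hfin : IsFiniteMeasure ρ₂ := isFiniteMeasure_of_heatPush_eq hb
    ((withDensity_absolutelyContinuous _ _).trans Measure.absolutelyContinuous_restrict) hρ₂
    fun s hs => heatPush_restrict_Iio_eq hb hρ₁ hρ₂ two_pos.le hm
      (integrable_exp_boundary hb hbdd hρ₁ two_pos) hint₂ heq hs
  have hall := fun α (hα : 0 < α) => integral_exp_boundary_eq hb hbdd hρ₁ hρ₂ heq hα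
  have hglt : ∫⁻ t in Ioi (0 : ℝ), g t ≠ ∞ := by
    have := measure_ne_top ρ₂ univ
    rwa [hρ₂def, withDensity_apply _ MeasurableSet.univ, Measure.restrict_univ] at this
  have hgtop := ae_lt_top hgm hglt
  have hz := hinj (fun t => (g t).toReal - f t)
    ((integrable_toReal_of_lintegral_ne_top hgm.aemeasurable hglt).sub hfi) (by
    intro α hα
    have hi₁ := integrable_exp_boundary hb hbdd hρ₁ hα
    have hi₂ := integrable_exp_boundary hb hbdd hρ₂ hα
    rw [integrable_withDensity_iff hfmeas.ennreal_ofReal (by simp)] at hi₁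
    rw [integrable_withDensity_iff hgm hgtop] at hi₂
    have hi₁' : IntegrableOn (fun t => exp (-α * b t - α ^ 2 * t / 2) * f t) (Ioi 0) := by
      refine hi₁.congr ?_
      filter_upwards [hf0] with t ht
      rw [ENNReal.toReal_ofReal ht]
    simp_rw [mul_sub]
    rw [integral_sub hi₂ hi₁', hr, hall α hα,
      integral_withDensity_eq_integral_toReal_smul hgm hgtop, sub_eq_zero]
    simp_rw [smul_eq_mul, mul_comm])
  have hρ₂univ : ρ₂ univ = 1 := by
    rw [hρ₂def, withDensity_apply _ MeasurableSet.univ, Measure.restrict_univ, ← hf1]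
    refine lintegral_congr_ae ?_
    filter_upwards [hz, hgtop] with t ht htop
    rw [← sub_eq_zero.1 ht, ENNReal.ofReal_toReal htop.ne]
  refine ⟨q, ⟨?_⟩, hq0, fun α hα => ?_, ?_⟩
  · have := lintegral_withDensity_mixtureDensity (e := 1) (c := 1) hKmeas hKnonneg hq0
      measurable_one (by simp) (by simpa using hKdens) (by simp)
    simp only [Pi.one_apply, ENNReal.ofReal_one, lintegral_one] at this
    rw [← this, hρ₂univ]
  · rw [← htrans α hα, ← hall α hα, hr]
  · filter_upwards [hz, ae_restrict_mem measurableSet_Ioi] with t ht ht0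
    rw [← sub_eq_zero.1 ht, integral_eq_lintegral_of_nonneg_ae]
    · rfl
    · filter_upwards [measure_eq_zero_iff_ae_notMem.1 hq0] with x hx
      exact hKnonneg t ht0 x (mem_Ici.2 (not_lt.1 hx))
    · exact (hKmeas.comp measurable_prodMk_left).aestronglyMeasurable

/-- **Existence for the randomized first passage time problem.**
If `r(α) = ∫₀^∞ e^{−αb(t)−α²t/2} f(t) dt` is completely monotone and the boundary transform
is injective on integrable functions, then there is a Borel probability measure `q` on `[0,∞)`
whose Laplace transform is `r` and which solves `∫ K(t,x) dq(x) = f(t)` for a.e. `t > 0`. -/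
theorem rfpt_existence
    (b : ℝ → ℝ) (hb : ContinuousOn b (Ici 0))
    (hbdd : ∀ α > (0 : ℝ), ∃ m : ℝ, ∀ t ∈ Ici (0 : ℝ), m ≤ b t + α * t)
    (K : ℝ → ℝ → ℝ) (hKmeas : Measurable (Function.uncurry K))
    (hKnonneg : ∀ t ∈ Ioi (0 : ℝ), ∀ x ∈ Ici (0 : ℝ), 0 ≤ K t x)
    (hK : ∀ x ∈ Ici (0 : ℝ), ∀ α > (0 : ℝ),
      ∫ t in Ioi (0 : ℝ), Real.exp (-α * b t - t * α ^ 2 / 2) * K t x = Real.exp (-α * x))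
    (hKdens : ∀ x ∈ Ici (0 : ℝ), ∫ t in Ioi (0 : ℝ), K t x = 1)
    (f : ℝ → ℝ) (hfmeas : Measurable f) (hfnonneg : ∀ t ∈ Ioi (0 : ℝ), 0 ≤ f t)
    (hfint : ∫ t in Ioi (0 : ℝ), f t = 1)
    (hCM : CompletelyMonotoneOn
      (fun α => ∫ t in Ioi (0 : ℝ), Real.exp (-α * b t - α ^ 2 * t / 2) * f t))
    (hinj : ∀ z : ℝ → ℝ, IntegrableOn z (Ioi 0) →
      (∀ α > (0 : ℝ), ∫ t in Ioi (0 : ℝ), Real.exp (-α * b t - α ^ 2 * t / 2) * z t = 0) →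
      ∀ᵐ t ∂(volume.restrict (Ioi (0 : ℝ))), z t = 0) :
    ∃ q : Measure ℝ, IsProbabilityMeasure q ∧ q (Iio 0) = 0 ∧
      (∀ α > (0 : ℝ), ∫ x, Real.exp (-α * x) ∂q
          = ∫ t in Ioi (0 : ℝ), Real.exp (-α * b t - α ^ 2 * t / 2) * f t) ∧
      ∀ᵐ t ∂(volume.restrict (Ioi (0 : ℝ))), ∫ x, K t x ∂q = f t := by
  have hc : Continuous fun t => b (max t 0) :=
    hb.comp_continuous (by fun_prop) fun t => le_max_right t 0
  have hr : ∀ (α : ℝ) (z : ℝ → ℝ),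
      ∫ t in Ioi (0 : ℝ), exp (-α * b t - α ^ 2 * t / 2) * z t =
        ∫ t in Ioi (0 : ℝ), exp (-α * b (max t 0) - α ^ 2 * t / 2) * z t := fun α z =>
    setIntegral_congr_fun measurableSet_Ioi fun t (ht : 0 < t) => by
      simp only [max_eq_left ht.le]
  simp_rw [hr] at hCM hinj ⊢
  refine rfpt_existence_of_continuous hc (fun α hα => ?_) hKmeas hKnonneg (fun α hα x hx => ?_)
    hKdens hfmeas hfnonneg hfint hCM hinj
  · obtain ⟨m, hm⟩ := hbdd α hα
    exact ⟨m, fun t ht => by simpa only [max_eq_left ht] using hm t ht⟩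
  · rw [← hr, ← hK x hx α hα]
    simp_rw [mul_comm (α ^ 2)]
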